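/- Let R = k[X,Y,Z]/(X^n+Y^n+Z^n) over an algebraically closed field of characteristic p > 0 with gcd(p,n) = 1, C = Proj R. Assume Syz_C(X,Y,Z) is strongly semistable and not trivialized by Frobenius. Write q = p^e = nθ + r with 0 ≤ r < n. Then HKF(R,q) = (3n/4)·q² - (3n/4)·r² + r³ if θ is even, and HKF(R,q) = (3n/4)·q² - (3n/4)·(n-r)² + (n-r)³ if θ is odd. -/

import Mathlib

open MvPolynomial

set_option synthInstance.maxHeartbeats 1000000
set_option maxHeartbeats 1000000

noncomputable section

/-- The linear map sending a tuple `s` to `∑ i, s i * g i`. -/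
def syzMap {R : Type*} [CommRing R] {N : ℕ} (g : Fin N → R) : (Fin N → R) →ₗ[R] R where
  toFun s := ∑ i, s i * g i
  map_add' := by intro s t; simp [add_mul, Finset.sum_add_distrib]
  map_smul' := by intro c s; simp [Finset.mul_sum, mul_assoc]

/-- The first syzygy module of `g 0, …, g (N-1)`. -/
def SyzOf {R : Type*} [CommRing R] {N : ℕ} (g : Fin N → R) : Submodule R (Fin N → R) :=
  LinearMap.ker (syzMap g)

/-! ### Syzygies with a Hilbert–Burch basis -/

/-- `a` is a nonzerodivisor and `b` is a nonzerodivisor modulo `a`. -/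
structure RegPair {R : Type*} [CommRing R] (a b : R) : Prop where
  eq_zero : ∀ t, a * t = 0 → t = 0
  dvd : ∀ t t', b * t = a * t' → a ∣ t

/-- The vector `h` is the cross product of `f` and `g`. -/
structure IsCross {R : Type*} [CommRing R] (f g h : Fin 3 → R) : Prop where
  zero : f 1 * g 2 - f 2 * g 1 = h 0
  one : f 2 * g 0 - f 0 * g 2 = h 1
  two : f 0 * g 1 - f 1 * g 0 = h 2

section HilbertBurch

variable {R : Type*} [CommRing R] {f g h : Fin 3 → R}

theorem IsCross.swap (H : IsCross f g h) : IsCross g (-f) h :=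
  ⟨by simp only [Pi.neg_apply]; linear_combination H.zero,
    by simp only [Pi.neg_apply]; linear_combination H.one,
    by simp only [Pi.neg_apply]; linear_combination H.two⟩

theorem IsCross.dot_left (H : IsCross f g h) : f 0 * h 0 + f 1 * h 1 + f 2 * h 2 = 0 := by
  rw [← H.zero, ← H.one, ← H.two]; ring

theorem IsCross.dot_right (H : IsCross f g h) : g 0 * h 0 + g 1 * h 1 + g 2 * h 2 = 0 := by
  rw [← H.zero, ← H.one, ← H.two]; ring

/-- A vector orthogonal to `h` has a cross product with `g ⊥ h` that is a multiple of `h`. -/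
theorem RegPair.exists_cross (reg : RegPair (h 0) (h 2)) {s : Fin 3 → R}
    (hs : s 0 * h 0 + s 1 * h 1 + s 2 * h 2 = 0)
    (hg : g 0 * h 0 + g 1 * h 1 + g 2 * h 2 = 0) :
    ∃ a : R, IsCross s g (a • h) := by
  obtain ⟨a, ha⟩ := reg.dvd (s 1 * g 2 - s 2 * g 1) (s 0 * g 1 - s 1 * g 0)
    (by linear_combination s 1 * hg - g 1 * hs)
  refine ⟨a, ?_, ?_, ?_⟩
  · simp only [Pi.smul_apply, smul_eq_mul]; linear_combination ha
  · rw [← sub_eq_zero]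
    apply reg.eq_zero
    simp only [Pi.smul_apply, smul_eq_mul]
    linear_combination h 1 * ha + g 2 * (-1) * hs + s 2 * hg
  · rw [← sub_eq_zero]
    apply reg.eq_zero
    simp only [Pi.smul_apply, smul_eq_mul]
    linear_combination h 2 * ha + g 1 * hs - s 1 * hg

theorem IsCross.exists_eq_add (H : IsCross f g h) (reg : RegPair (h 0) (h 2)) {s : Fin 3 → R}
    (hs : s 0 * h 0 + s 1 * h 1 + s 2 * h 2 = 0) :
    ∃ a b : R, (∀ i, s i = a * f i + b * g i) ∧ IsCross f s (b • h) := by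
  obtain ⟨a, ha⟩ := reg.exists_cross hs H.dot_right
  obtain ⟨b, hb⟩ := reg.exists_cross H.dot_left hs
  refine ⟨a, b, fun i ↦ ?_, hb⟩
  rw [← sub_eq_zero]
  apply reg.eq_zero
  have a0 := ha.zero
  have b0 := hb.zero
  simp only [Pi.smul_apply, smul_eq_mul] at a0 b0
  have h0 := H.zero
  have hs' : s 0 * (f 1 * g 2 - f 2 * g 1) + s 1 * (f 2 * g 0 - f 0 * g 2) +
      s 2 * (f 0 * g 1 - f 1 * g 0) = 0 := by rw [H.zero, H.one, H.two]; exact hs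
  have key : h 0 * s i = (a * h 0) * f i + (b * h 0) * g i := by
    rw [← a0, ← b0, ← h0]
    fin_cases i
    · simp only [Fin.mk_zero]; linear_combination hs'
    · simp only [Fin.mk_one]; ring
    · simp only [Fin.reduceFinMk]; ring
  linear_combination key

/-- If `h` is a cross product `f × g` and contains a regular pair, then `f, g` form a basis of
the syzygy module of `h`. -/
theorem IsCross.free_syzOf (H : IsCross f g h) (reg : RegPair (h 0) (h 2)) :
    Module.Free R (SyzOf h) := by
  have hmem : ∀ s : Fin 3 → R, s ∈ SyzOf h ↔ s 0 * h 0 + s 1 * h 1 + s 2 * h 2 = 0 := by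
    intro s
    simp [SyzOf, syzMap, Fin.sum_univ_three]
  let φ : (R × R) →ₗ[R] SyzOf h :=
    LinearMap.codRestrict (SyzOf h)
      ((LinearMap.toSpanSingleton R _ f).coprod (LinearMap.toSpanSingleton R _ g)) (by
        rintro ⟨a, b⟩
        rw [hmem]
        simp only [LinearMap.coprod_apply, LinearMap.toSpanSingleton_apply, Pi.add_apply,
          Pi.smul_apply, smul_eq_mul]
        linear_combination a * H.dot_left + b * H.dot_right)
  have hφ : ∀ a b i, (φ (a, b) : Fin 3 → R) i = a * f i + b * g i := by
    intro a b i; simp [φ]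
  refine Module.Free.of_equiv (LinearEquiv.ofBijective φ ⟨?_, ?_⟩)
  · rw [injective_iff_map_eq_zero]
    rintro ⟨a, b⟩ hab
    have e : ∀ i, a * f i + b * g i = 0 := fun i ↦ by rw [← hφ, hab]; rfl
    have h0 := H.zero
    refine Prod.ext (reg.eq_zero _ ?_) (reg.eq_zero _ ?_)
    · simp only; linear_combination (-a) * h0 + g 2 * e 1 - g 1 * e 2
    · simp only; linear_combination (-b) * h0 - f 2 * e 1 + f 1 * e 2
  · rintro ⟨s, hs⟩
    obtain ⟨a, b, hab, -⟩ := H.exists_eq_add reg ((hmem s).1 hs)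
    exact ⟨(a, b), Subtype.ext (funext fun i ↦ (hφ a b i).trans (hab i).symm)⟩

end HilbertBurch

/-! ### Adjoining an `n`-th root -/

/-- `B'` is obtained from `B` by freely adjoining an `n`-th root `x` of `u`: the powers
`1, x, …, x ^ (n - 1)` form a `B`-basis of `B'`. -/
structure IsRootExt (n : ℕ) {B B' : Type*} [CommRing B] [CommRing B'] (ψ : B →+* B') (u : B)
    (x : B') : Prop where
  pow_eq : x ^ n = ψ u
  bijective : Function.Bijective fun c : Fin n → B ↦ ∑ i, ψ (c i) * x ^ (i : ℕ)

namespace IsRootExt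

section

variable {n : ℕ} {B B' : Type*} [CommRing B] [CommRing B'] {ψ : B →+* B'} {u : B} {x : B'}

theorem regPair (H : IsRootExt n ψ u x) {a b : B} (hab : RegPair a b) :
    RegPair (ψ a) (ψ b) := by
  have mul_coord : ∀ (a : B) (c : Fin n → B),
      ψ a * ∑ i, ψ (c i) * x ^ (i : ℕ) = ∑ i, ψ (a * c i) * x ^ (i : ℕ) := by
    intro a c
    rw [Finset.mul_sum]
    exact Finset.sum_congr rfl fun i _ ↦ by rw [map_mul, mul_assoc]
  constructor
  · intro t ht
    obtain ⟨c, rfl⟩ := H.bijective.2 t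
    simp only [mul_coord] at ht
    have : (fun i ↦ a * c i) = 0 := H.bijective.1 (by simpa using ht)
    have hc : c = 0 := funext fun i ↦ hab.eq_zero _ (congrFun this i)
    simp [hc]
  · intro t t' h
    obtain ⟨c, rfl⟩ := H.bijective.2 t
    obtain ⟨c', rfl⟩ := H.bijective.2 t'
    simp only [mul_coord] at h
    have h' : (fun i ↦ b * c i) = fun i ↦ a * c' i := H.bijective.1 h
    choose d hd using fun i ↦ hab.dvd _ _ (congrFun h' i)
    refine ⟨∑ i, ψ (d i) * x ^ (i : ℕ), ?_⟩
    simp only [mul_coord, ← hd]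

/-- Membership in `I B' + (x ^ q)` in terms of coordinates. -/
theorem sum_mem_iff (H : IsRootExt n ψ u x) (hn : 0 < n) (I : Ideal B) (q : ℕ) (c : Fin n → B) :
    ∑ i, ψ (c i) * x ^ (i : ℕ) ∈ I.map ψ ⊔ Ideal.span {x ^ q} ↔
      ∀ i : Fin n, c i ∈ I ⊔ Ideal.span {u ^ (if (i : ℕ) < q % n then q / n + 1 else q / n)} := by
  have hq := Nat.div_add_mod q n
  constructor
  · let P : AddSubmonoid B' :=
      { carrier := {t | ∃ c : Fin n → B, t = ∑ i, ψ (c i) * x ^ (i : ℕ) ∧ ∀ i : Fin n,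
          c i ∈ I ⊔ Ideal.span {u ^ (if (i : ℕ) < q % n then q / n + 1 else q / n)}}
        zero_mem' := ⟨0, by simp, fun i ↦ by simp⟩
        add_mem' := by
          rintro _ _ ⟨c, rfl, hc⟩ ⟨d, rfl, hd⟩
          exact ⟨c + d, by simp [add_mul, Finset.sum_add_distrib],
            fun i ↦ Ideal.add_mem _ (hc i) (hd i)⟩ }
    have single : ∀ (i : Fin n) (b : B),
        b ∈ I ⊔ Ideal.span {u ^ (if (i : ℕ) < q % n then q / n + 1 else q / n)} →
        ψ b * x ^ (i : ℕ) ∈ P := by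
      intro i b hb
      refine ⟨Pi.single i b, ?_, fun j ↦ ?_⟩
      · rw [Finset.sum_eq_single i]
        · simp
        · intro j _ hj; simp [Pi.single_eq_of_ne hj]
        · simp
      · by_cases hj : j = i
        · subst hj; simpa using hb
        · simp [Pi.single_eq_of_ne hj]
    have memP : ∀ t ∈ I.map ψ ⊔ Ideal.span {x ^ q}, t ∈ P := by
      intro t ht
      obtain ⟨t₁, h₁, t₂, h₂, rfl⟩ := Submodule.mem_sup.1 ht
      refine P.add_mem ?_ ?_
      · suffices ∀ s, s * t₁ ∈ P by simpa using this 1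
        rw [Ideal.map] at h₁
        clear ht
        induction h₁ using Submodule.span_induction with
        | mem y hy =>
          obtain ⟨b, hb, rfl⟩ := hy
          intro s
          obtain ⟨d, rfl⟩ := H.bijective.2 s
          simp only [Finset.sum_mul]
          refine P.sum_mem fun i _ ↦ ?_
          have := single i (d i * b) (Ideal.mem_sup_left (I.mul_mem_left _ hb))
          rwa [map_mul, mul_right_comm] at this
        | zero => intro s; rw [mul_zero]; exact P.zero_mem
        | add y z _ _ hy hz => intro s; rw [mul_add]; exact P.add_mem (hy s) (hz s)
        | smul a y _ hy => intro s; rw [smul_eq_mul, ← mul_assoc]; exact hy _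
      · obtain ⟨s, rfl⟩ := Ideal.mem_span_singleton'.1 h₂
        obtain ⟨d, rfl⟩ := H.bijective.2 s
        simp only [Finset.sum_mul]
        refine P.sum_mem fun i _ ↦ ?_
        have hm := Nat.div_add_mod (q + i) n
        have := single ⟨(q + i) % n, Nat.mod_lt _ hn⟩ (d i * u ^ ((q + i) / n)) ?_
        · have e : ψ (d i) * x ^ (i : ℕ) * x ^ q =
            ψ (d i * u ^ ((q + i) / n)) * x ^ ((q + i) % n) := by
            rw [map_mul, map_pow, ← H.pow_eq, ← pow_mul, mul_assoc, mul_assoc, ← pow_add,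
              ← pow_add, hm, add_comm q]
          rw [e]; exact this
        · refine Ideal.mem_sup_right (Ideal.mem_span_singleton.2 (Dvd.dvd.mul_left
            (pow_dvd_pow _ ?_) _))
          simp only
          have h1 : q / n ≤ (q + i) / n := Nat.div_le_div_right (by omega)
          split_ifs with h
          · by_contra hlt
            have h2 : (q + i) / n = q / n := by omega
            rw [h2] at hm
            omega
          · exact h1
    intro h
    obtain ⟨d, hd, hd'⟩ := memP _ h
    rwa [H.bijective.1 hd]
  · intro hc
    refine Ideal.sum_mem _ fun i _ ↦ ?_
    obtain ⟨b, hb, b', hb', e⟩ := Submodule.mem_sup.1 (hc i)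
    obtain ⟨s, rfl⟩ := Ideal.mem_span_singleton'.1 hb'
    rw [← e, map_add, add_mul]
    refine Ideal.add_mem _ (Ideal.mul_mem_right _ _ (Ideal.mem_sup_left
      (Ideal.mem_map_of_mem _ hb))) (Ideal.mem_sup_right (Ideal.mem_span_singleton.2 ?_))
    rw [map_mul, map_pow, ← H.pow_eq, ← pow_mul, mul_assoc, ← pow_add]
    refine Dvd.dvd.mul_left (pow_dvd_pow _ ?_) _
    split_ifs with h
    · rw [mul_add]; have := Nat.mod_lt q hn; omega
    · omega

end

section

variable {k : Type*} [Field k] {n : ℕ} {B B' : Type*} [CommRing B] [CommRing B'] [Algebra k B]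
  [Algebra k B'] {ψ : B →ₐ[k] B'} {u : B} {x : B'}

theorem length_quotient (H : IsRootExt n (ψ : B →+* B') u x) (hn : 0 < n) (I : Ideal B) (q : ℕ) :
    Module.length k (B' ⧸ (I.map (ψ : B →+* B') ⊔ Ideal.span {x ^ q})) =
      ∑ i : Fin n, Module.length k
        (B ⧸ (I ⊔ Ideal.span {u ^ (if (i : ℕ) < q % n then q / n + 1 else q / n)})) := by
  let J : Fin n → Ideal B := fun i ↦
    I ⊔ Ideal.span {u ^ (if (i : ℕ) < q % n then q / n + 1 else q / n)}
  let e : (Fin n → B) →ₗ[k] B' :=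
    { toFun := fun c ↦ ∑ i, ψ (c i) * x ^ (i : ℕ)
      map_add' := by intro c d; simp [add_mul, Finset.sum_add_distrib]
      map_smul' := by intro a c; simp [Finset.smul_sum] }
  let f := (Ideal.Quotient.mkₐ k (I.map (ψ : B →+* B') ⊔ Ideal.span {x ^ q})).toLinearMap ∘ₗ e
  let g : (Fin n → B) →ₗ[k] ∀ i, B ⧸ J i :=
    LinearMap.pi fun i ↦ (Ideal.Quotient.mkₐ k (J i)).toLinearMap ∘ₗ LinearMap.proj i
  have hf : Function.Surjective f :=
    (Ideal.Quotient.mkₐ_surjective k _).comp H.bijective.2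
  have hg : Function.Surjective g := by
    intro c
    choose d hd using fun i ↦ Ideal.Quotient.mkₐ_surjective k (J i) (c i)
    exact ⟨d, funext hd⟩
  have hker : LinearMap.ker f = LinearMap.ker g := by
    ext c
    rw [LinearMap.mem_ker, LinearMap.mem_ker, funext_iff]
    refine (Ideal.Quotient.eq_zero_iff_mem.trans (H.sum_mem_iff hn I q c)).trans ?_
    exact forall_congr' fun i ↦ Ideal.Quotient.eq_zero_iff_mem.symm
  rw [← Module.length_pi_of_fintype]
  exact ((f.quotKerEquivOfSurjective hf).symm.trans ((Submodule.quotEquivOfEq _ _ hker).trans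
    (g.quotKerEquivOfSurjective hg))).length_eq

theorem algHom_ext {E : Type*} [CommRing E] [Algebra k E] (H : IsRootExt n (ψ : B →+* B') u x)
    {η η' : B' →ₐ[k] E} (hψ : ∀ b, η (ψ b) = η' (ψ b)) (hx : η x = η' x) : η = η' := by
  ext t
  obtain ⟨c, rfl⟩ := H.bijective.2 t
  simp [hψ, hx]

end

end IsRootExt

universe u

/-- The ring `B[x] / (x ^ n - u)`, with its universal property. -/
theorem exists_isRootExt {k : Type u} [Field k] {n : ℕ} (hn : 0 < n) (B : Type u) [CommRing B]
    [Algebra k B] (u : B) :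
    ∃ (B' : Type u) (_ : CommRing B') (_ : Algebra k B') (ψ : B →ₐ[k] B') (x : B'),
      IsRootExt n (ψ : B →+* B') u x ∧
      ∀ (E : Type u) [CommRing E] [Algebra k E] (η : B →ₐ[k] E) (e : E), e ^ n = η u →
        ∃ η' : B' →ₐ[k] E, (∀ b, η' (ψ b) = η b) ∧ η' x = e := by
  rcases subsingleton_or_nontrivial B with hB | hB
  · refine ⟨B, inferInstance, inferInstance, AlgHom.id k B, 0, ⟨Subsingleton.elim _ _,
      Function.injective_of_subsingleton _, fun b ↦ ⟨0, Subsingleton.elim _ _⟩⟩,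
      fun E _ _ η e _ ↦ ⟨η, fun b ↦ rfl, ?_⟩⟩
    have : Subsingleton E := by
      refine subsingleton_of_zero_eq_one ?_
      rw [← map_one η, Subsingleton.elim (1 : B) 0, map_zero]
    exact Subsingleton.elim _ _
  let P : Polynomial B := Polynomial.X ^ n - Polynomial.C u
  have hP : P.Monic := Polynomial.monic_X_pow_sub_C u hn.ne'
  have hdeg : P.natDegree = n := Polynomial.natDegree_X_pow_sub_C
  let pb := AdjoinRoot.powerBasis' hP
  refine ⟨AdjoinRoot P, inferInstance, inferInstance, AdjoinRoot.ofAlgHom k P, AdjoinRoot.root P,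
    ⟨?_, ?_⟩, ?_⟩
  · have := AdjoinRoot.eval₂_root P
    simpa [P, sub_eq_zero] using this
  · let b : Module.Basis (Fin n) B (AdjoinRoot P) := pb.basis.reindex (finCongr hdeg)
    have hb : ∀ i, b i = AdjoinRoot.root P ^ (i : ℕ) := by
      intro i; simp [b, pb]; rfl
    convert b.equivFun.symm.bijective using 1
    funext c
    simp [Module.Basis.equivFun_symm_apply, hb, Algebra.smul_def]
  · intro E _ _ η e he
    refine ⟨AdjoinRoot.liftAlgHom P η e (by simp [P, he]), fun b ↦ ?_, ?_⟩
    · simp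
    · simp

/-! ### The Fermat ring over the plane -/

/-- The three linear forms `u, v, w` with `u + v + w = 0` on `k[u, w]`. -/
def linForm (k : Type*) [Field k] : Fin 3 → MvPolynomial (Fin 2) k :=
  ![X 0, -(X 0 + X 1), X 1]

/-- The length of `k[u, w] / (u ^ a, v ^ b, w ^ c)`. -/
def planeLength (k : Type*) [Field k] (a b c : ℕ) : ℕ∞ :=
  Module.length k (MvPolynomial (Fin 2) k ⧸
    Ideal.span {linForm k 0 ^ a, linForm k 1 ^ b, linForm k 2 ^ c})

theorem fermat_tower (k : Type u) [Field k] {n : ℕ} (hn : 0 < n)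
    (I : Ideal (MvPolynomial (Fin 3) k)) (hI : I = Ideal.span {X 0 ^ n + X 1 ^ n + X 2 ^ n}) :
    ∃ φ : MvPolynomial (Fin 2) k →ₐ[k] MvPolynomial (Fin 3) k ⧸ I,
      (∀ i, φ (linForm k i) = Ideal.Quotient.mk I (X i) ^ n) ∧
      (∀ a b, RegPair a b → RegPair (φ a) (φ b)) ∧
      ∀ q, Module.length k ((MvPolynomial (Fin 3) k ⧸ I) ⧸
          Ideal.span {Ideal.Quotient.mk I (X 0) ^ q, Ideal.Quotient.mk I (X 1) ^ q,
            Ideal.Quotient.mk I (X 2) ^ q}) =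
        ∑ l : Fin n, ∑ j : Fin n, ∑ i : Fin n, planeLength k
          (if (i : ℕ) < q % n then q / n + 1 else q / n)
          (if (j : ℕ) < q % n then q / n + 1 else q / n)
          (if (l : ℕ) < q % n then q / n + 1 else q / n) := by
  obtain ⟨T₁, _, _, ψ₁, x₁, H₁, univ₁⟩ :=
    exists_isRootExt (k := k) hn (MvPolynomial (Fin 2) k) (linForm k 0)
  obtain ⟨T₂, _, _, ψ₂, x₂, H₂, univ₂⟩ := exists_isRootExt (k := k) hn T₁ (ψ₁ (linForm k 1))
  obtain ⟨T₃, _, _, ψ₃, x₃, H₃, univ₃⟩ :=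
    exists_isRootExt (k := k) hn T₂ (ψ₂ (ψ₁ (linForm k 2)))
  have hx₁ : x₁ ^ n = ψ₁ (linForm k 0) := H₁.pow_eq
  have hx₂ : x₂ ^ n = ψ₂ (ψ₁ (linForm k 1)) := H₂.pow_eq
  have hx₃ : x₃ ^ n = ψ₃ (ψ₂ (ψ₁ (linForm k 2))) := H₃.pow_eq
  set R := MvPolynomial (Fin 3) k ⧸ I with hR
  let x : Fin 3 → R := fun i ↦ Ideal.Quotient.mk I (X i)
  have hrel : x 0 ^ n + x 1 ^ n + x 2 ^ n = 0 := by
    simp only [x, ← map_pow, ← map_add]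
    rw [Ideal.Quotient.eq_zero_iff_mem, hI]
    exact Ideal.mem_span_singleton_self _
  let φ : MvPolynomial (Fin 2) k →ₐ[k] R := aeval ![x 0 ^ n, x 2 ^ n]
  have hφ : ∀ i, φ (linForm k i) = x i ^ n := by
    intro i
    fin_cases i
    · simp [φ, linForm]
    · simp only [φ, linForm, Fin.mk_one, Matrix.cons_val_one, map_neg, map_add, aeval_X,
        Matrix.cons_val_zero]
      linear_combination (-1 : R) * hrel
    · simp [φ, linForm]
  obtain ⟨η₁, hη₁, hη₁x⟩ := univ₁ R φ (x 0) (hφ 0).symm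
  obtain ⟨η₂, hη₂, hη₂x⟩ := univ₂ R η₁ (x 1) ((hη₁ _).trans (hφ 1)).symm
  obtain ⟨η₃, hη₃, hη₃x⟩ := univ₃ R η₂ (x 2) ((hη₂ _).trans ((hη₁ _).trans (hφ 2))).symm
  let ρ : R →ₐ[k] T₃ := Ideal.Quotient.liftₐ I (aeval ![ψ₃ (ψ₂ x₁), ψ₃ x₂, x₃]) (by
    intro a ha
    rw [hI] at ha
    obtain ⟨s, rfl⟩ := Ideal.mem_span_singleton'.1 ha
    have : ψ₃ (ψ₂ x₁) ^ n + ψ₃ x₂ ^ n + x₃ ^ n = 0 := by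
      rw [hx₃, ← map_pow ψ₃, ← map_pow ψ₃, hx₂, ← map_pow ψ₂, hx₁]
      simp [linForm]
    simp [this])
  have hρ : ∀ i, ρ (x i) = (![ψ₃ (ψ₂ x₁), ψ₃ x₂, x₃] : Fin 3 → T₃) i := by
    intro i
    simp only [ρ, x]
    erw [Ideal.Quotient.liftₐ_apply, Ideal.Quotient.lift_mk]
    simp
  have hσρ : η₃.comp ρ = AlgHom.id k R := by
    apply Ideal.Quotient.algHom_ext
    apply MvPolynomial.algHom_ext
    intro i
    change η₃ (ρ (x i)) = x i
    rw [hρ]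
    fin_cases i
    · simp [hη₃, hη₂, hη₁x]
    · simp [hη₃, hη₂x]
    · simp [hη₃x]
  have hρσ : ρ.comp η₃ = AlgHom.id k T₃ := by
    have h0 : (ρ.comp φ) = (ψ₃.comp (ψ₂.comp ψ₁)) := by
      apply MvPolynomial.algHom_ext
      intro i
      fin_cases i
      · have := hx₁
        simp only [linForm, Matrix.cons_val_zero] at this
        simp [φ, hρ, ← this]
      · have := hx₃
        simp only [linForm, Matrix.cons_val] at this
        simp [φ, hρ, ← this]
    have h1 : ρ.comp η₁ = ψ₃.comp ψ₂ :=
      H₁.algHom_ext (fun b ↦ by simpa [hη₁] using DFunLike.congr_fun h0 b) (by simp [hη₁x, hρ])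
    have h2 : ρ.comp η₂ = ψ₃ :=
      H₂.algHom_ext (fun b ↦ by simpa [hη₂] using DFunLike.congr_fun h1 b) (by simp [hη₂x, hρ])
    exact H₃.algHom_ext (fun b ↦ by simpa [hη₃] using DFunLike.congr_fun h2 b)
      (by simp [hη₃x, hρ])
  let σ : T₃ ≃ₐ[k] R := AlgEquiv.ofAlgHom η₃ ρ hσρ hρσ
  have hσφ : ∀ a, φ a = σ (ψ₃ (ψ₂ (ψ₁ a))) := fun a ↦ by
    change φ a = η₃ _
    rw [hη₃, hη₂, hη₁]
  refine ⟨φ, hφ, fun a b hab ↦ ?_, fun q ↦ ?_⟩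
  · have h3 := H₃.regPair (H₂.regPair (H₁.regPair hab))
    simp only [AlgHom.coe_toRingHom] at h3
    rw [hσφ, hσφ]
    constructor
    · intro t ht
      have := h3.eq_zero (σ.symm t) (by
        apply σ.injective
        simpa using ht)
      simpa using this
    · intro t t' ht
      have := h3.dvd (σ.symm t) (σ.symm t') (by
        apply σ.injective
        simpa using ht)
      simpa using map_dvd σ this
  · set ex : ℕ → ℕ := fun i ↦ if i < q % n then q / n + 1 else q / n with hex
    have s₃ := H₃.length_quotient hn (Ideal.span {x₂ ^ q, ψ₂ x₁ ^ q}) q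
    have e : Module.length k (R ⧸ Ideal.span {x 0 ^ q, x 1 ^ q, x 2 ^ q}) =
        Module.length k (T₃ ⧸ ((Ideal.span {x₂ ^ q, ψ₂ x₁ ^ q}).map (ψ₃ : T₂ →+* T₃) ⊔
          Ideal.span {x₃ ^ q})) := by
      refine LinearEquiv.length_eq (AlgEquiv.toLinearEquiv
        (Ideal.quotientEquivAlg _ _ σ.symm ?_))
      have hs : ∀ i, σ.symm (x i) = (![ψ₃ (ψ₂ x₁), ψ₃ x₂, x₃] : Fin 3 → T₃) i := hρ
      rw [Ideal.map_span, Ideal.map_span, ← Ideal.span_union]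
      congr 1
      simp only [Set.image_insert_eq, Set.image_singleton, map_pow, RingHom.coe_coe, hs,
        Matrix.cons_val]
      ext t
      simp only [Set.mem_union, Set.mem_insert_iff, Set.mem_singleton_iff]
      tauto
    refine e.trans (s₃.trans (Finset.sum_congr rfl fun l _ ↦ ?_))
    have s₂ := H₂.length_quotient hn (Ideal.span {ψ₁ (linForm k 2) ^ ex l, x₁ ^ q}) q
    have e₂ : Ideal.span {x₂ ^ q, ψ₂ x₁ ^ q} ⊔ Ideal.span {ψ₂ (ψ₁ (linForm k 2)) ^ ex l} =
        (Ideal.span {ψ₁ (linForm k 2) ^ ex l, x₁ ^ q}).map (ψ₂ : T₁ →+* T₂) ⊔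
          Ideal.span {x₂ ^ q} := by
      rw [Ideal.map_span, ← Ideal.span_union, ← Ideal.span_union]
      congr 1
      simp only [Set.image_insert_eq, Set.image_singleton, map_pow, RingHom.coe_coe]
      ext t
      simp only [Set.mem_union, Set.mem_insert_iff, Set.mem_singleton_iff]
      tauto
    rw [e₂]
    refine s₂.trans (Finset.sum_congr rfl fun j _ ↦ ?_)
    have s₁ := H₁.length_quotient hn (Ideal.span {linForm k 2 ^ ex l, linForm k 1 ^ ex j}) q
    have e₁ : Ideal.span {ψ₁ (linForm k 2) ^ ex l, x₁ ^ q} ⊔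
        Ideal.span {ψ₁ (linForm k 1) ^ ex j} =
        (Ideal.span {linForm k 2 ^ ex l, linForm k 1 ^ ex j}).map
          (ψ₁ : MvPolynomial (Fin 2) k →+* T₁) ⊔ Ideal.span {x₁ ^ q} := by
      rw [Ideal.map_span, ← Ideal.span_union, ← Ideal.span_union]
      congr 1
      simp only [Set.image_insert_eq, Set.image_singleton, map_pow, RingHom.coe_coe]
      ext t
      simp only [Set.mem_union, Set.mem_insert_iff, Set.mem_singleton_iff]
      tauto
    rw [e₁]
    refine s₁.trans (Finset.sum_congr rfl fun i _ ↦ ?_)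
    have e₀ : Ideal.span {linForm k 2 ^ ex l, linForm k 1 ^ ex j} ⊔
        Ideal.span {linForm k 0 ^ ex i} =
        Ideal.span {linForm k 0 ^ ex i, linForm k 1 ^ ex j, linForm k 2 ^ ex l} := by
      rw [← Ideal.span_union]
      congr 1
      ext t
      simp only [Set.mem_union, Set.mem_insert_iff, Set.mem_singleton_iff]
      tauto
    rw [e₀, planeLength]

/-! ### Homogeneous syzygies in the plane -/

section Plane

variable {k : Type*} [Field k]

/-- `F` is homogeneous of degree `α - a`, and zero if this number is negative. -/
def IsHomOf (F : MvPolynomial (Fin 2) k) (a α : ℕ) : Prop :=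
  F = 0 ∨ ∃ d, d + a = α ∧ F.IsHomogeneous d

namespace IsHomOf

variable {F G : MvPolynomial (Fin 2) k} {a α : ℕ}

theorem sub (hF : IsHomOf F a α) (hG : IsHomOf G a α) : IsHomOf (F - G) a α := by
  rcases hG with rfl | ⟨d, hd, hG⟩
  · simpa using hF
  rcases hF with rfl | ⟨d', hd', hF⟩
  · exact Or.inr ⟨d, hd, by simpa using hG.neg⟩
  · obtain rfl : d' = d := by omega
    exact Or.inr ⟨d', hd, hF.sub hG⟩

theorem neg (hF : IsHomOf F a α) : IsHomOf (-F) a α := by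
  simpa using IsHomOf.sub (F := 0) (Or.inl rfl) hF

theorem sum {ι : Type*} {s : Finset ι} {F : ι → MvPolynomial (Fin 2) k}
    (hF : ∀ i ∈ s, IsHomOf (F i) a α) : IsHomOf (∑ i ∈ s, F i) a α :=
  Finset.sum_induction _ (IsHomOf · a α)
    (fun F G hF hG ↦ by simpa using hF.sub hG.neg) (Or.inl rfl) hF

theorem mul_left (hF : IsHomOf F a α) {m : ℕ} (hG : G.IsHomogeneous m) :
    IsHomOf (G * F) a (α + m) := by
  rcases hF with rfl | ⟨d, hd, hF⟩
  · exact Or.inl (mul_zero _)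
  · exact Or.inr ⟨m + d, by omega, hG.mul hF⟩

theorem succ (hF : IsHomOf F a α) : IsHomOf F (a + 1) (α + 1) :=
  hF.imp_right fun ⟨d, hd, h⟩ ↦ ⟨d, by omega, h⟩

theorem totalDegree_le (hF : IsHomOf F a α) (h0 : F ≠ 0) : F.totalDegree + a ≤ α := by
  obtain ⟨d, hd, hF⟩ := hF.resolve_left h0
  have := hF.totalDegree_le
  omega

end IsHomOf

theorem IsHomogeneous.exists_eq_add_X_mul {F : MvPolynomial (Fin 2) k} {d : ℕ}
    (hF : F.IsHomogeneous d) :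
    ∃ (κ : k) (G : MvPolynomial (Fin 2) k), F = C κ * X 0 ^ d + X 1 * G ∧ IsHomOf G 1 d := by
  have key : ∀ m ∈ F.support, ∃ (κ : k) (G : MvPolynomial (Fin 2) k),
      monomial m (coeff m F) = C κ * X 0 ^ d + X 1 * G ∧ IsHomOf G 1 d := by
    intro m hm
    have hd : m 0 + m 1 = d := by
      have := hF (mem_support_iff.1 hm)
      rwa [Finsupp.weight_apply, Finsupp.sum_fintype _ _ (by simp), Fin.sum_univ_two, Pi.one_apply,
        Pi.one_apply, smul_eq_mul, smul_eq_mul, mul_one, mul_one] at this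
    have e : monomial m (coeff m F) = C (coeff m F) * (X 0 ^ m 0 * X 1 ^ m 1) := by
      rw [monomial_eq, Finsupp.prod_fintype _ _ (by simp), Fin.prod_univ_two]
    rcases Nat.eq_zero_or_pos (m 1) with h1 | h1
    · refine ⟨coeff m F, 0, ?_, Or.inl rfl⟩
      rw [e, h1, ← hd, h1]; simp
    · refine ⟨0, C (coeff m F) * (X 0 ^ m 0 * X 1 ^ (m 1 - 1)), ?_,
        Or.inr ⟨0 + (m 0 + (m 1 - 1)), by omega, (isHomogeneous_C _ _).mul
          ((isHomogeneous_X_pow _ _).mul (isHomogeneous_X_pow _ _))⟩⟩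
      rw [e, ← Nat.sub_add_cancel h1, pow_succ, Nat.add_sub_cancel, C_0]; ring
  choose! κ G h1 h2 using key
  refine ⟨∑ m ∈ F.support, κ m, ∑ m ∈ F.support, G m, ?_, IsHomOf.sum h2⟩
  conv_lhs => rw [F.as_sum]
  rw [Finset.sum_congr rfl h1, Finset.sum_add_distrib, map_sum, Finset.sum_mul, Finset.mul_sum]

theorem IsHomOf.exists_eq_add_X_mul {F : MvPolynomial (Fin 2) k} {a α : ℕ}
    (hF : IsHomOf F a α) :
    ∃ (κ : k) (G : MvPolynomial (Fin 2) k),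
      F = C κ * X 0 ^ (α - a) + X 1 * G ∧ IsHomOf G (a + 1) α ∧ (κ ≠ 0 → a ≤ α) := by
  rcases hF with rfl | ⟨d, hd, hF⟩
  · exact ⟨0, 0, by simp, Or.inl rfl, by simp⟩
  · obtain ⟨κ, G, e, hG⟩ := IsHomogeneous.exists_eq_add_X_mul hF
    refine ⟨κ, G, ?_, hG.imp_right ?_, fun _ ↦ by omega⟩
    · rw [e, ← hd, Nat.add_sub_cancel]
    · rintro ⟨d', h, h'⟩
      exact ⟨d', by omega, h'⟩

theorem regPair_X_pow (a c : ℕ) :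
    RegPair (X 0 ^ a : MvPolynomial (Fin 2) k) (X 1 ^ c) := by
  have h0 : Prime (X 0 : MvPolynomial (Fin 2) k) := X_prime
  refine ⟨fun t ht ↦ (mul_eq_zero.1 ht).resolve_left (pow_ne_zero _ h0.ne_zero), fun t t' h ↦ ?_⟩
  refine h0.pow_dvd_of_dvd_mul_left a (fun hd ↦ ?_) ⟨t', h⟩
  have := h0.dvd_of_dvd_pow hd
  rw [X_dvd_X] at this
  simp at this

/-- A homogeneous basis `f, g` of the syzygies of `u ^ a, v ^ b, w ^ c`, in degrees `α, β`. -/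
structure IsPlaneBasis (e : Fin 3 → ℕ) (α β : ℕ) (f g : Fin 3 → MvPolynomial (Fin 2) k) :
    Prop where
  cross : IsCross f g fun i ↦ linForm k i ^ e i
  left : ∀ i, IsHomOf (f i) (e i) α
  right : ∀ i, IsHomOf (g i) (e i) β

theorem IsPlaneBasis.swap {e : Fin 3 → ℕ} {α β : ℕ} {f g : Fin 3 → MvPolynomial (Fin 2) k}
    (H : IsPlaneBasis e α β f g) : IsPlaneBasis e β α g (-f) :=
  ⟨H.cross.swap, H.right, fun i ↦ (H.left i).neg⟩

/-- After a change of basis, the last entry of `f` vanishes on the line `w = 0`, and that of `g`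
does not. -/
theorem IsPlaneBasis.exists_normalized {e : Fin 3 → ℕ} {α β : ℕ}
    {f g : Fin 3 → MvPolynomial (Fin 2) k} (H : IsPlaneBasis e α β f g) :
    ∃ (α' β' : ℕ) (f' g' : Fin 3 → MvPolynomial (Fin 2) k) (F G : MvPolynomial (Fin 2) k) (κ : k),
      IsPlaneBasis e α' β' f' g' ∧ (α' = α ∧ β' = β ∨ α' = β ∧ β' = α) ∧
      f' 2 = X 1 * F ∧ IsHomOf F (e 2 + 1) α' ∧
      g' 2 = C κ * X 0 ^ (β' - e 2) + X 1 * G ∧ κ ≠ 0 ∧ e 2 ≤ β' := by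
  wlog hαβ : α ≤ β generalizing α β f g
  · obtain ⟨α', β', f', g', F, G, κ, h1, h2, h3⟩ := this H.swap (by omega)
    exact ⟨α', β', f', g', F, G, κ, h1, h2.symm, h3⟩
  obtain ⟨κ, F, hF, hF', hκ⟩ := (H.left 2).exists_eq_add_X_mul
  obtain ⟨μ, G, hG, hG', hμ⟩ := (H.right 2).exists_eq_add_X_mul
  by_cases h0 : κ = 0
  · subst h0
    have hμ0 : μ ≠ 0 := by
      rintro rfl
      have h := H.cross.zero
      rw [hF, hG] at h
      have : (X 1 : MvPolynomial (Fin 2) k) ∣ X 0 ^ e 0 :=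
        ⟨f 1 * G - F * g 1, by simp [linForm] at h; linear_combination -h⟩
      have := (X_prime (i := (1 : Fin 2)) (R := k)).dvd_of_dvd_pow this
      rw [X_dvd_X] at this
      simp at this
    exact ⟨α, β, f, g, F, G, μ, H, Or.inl ⟨rfl, rfl⟩, by simpa using hF, hF', hG, hμ0, hμ hμ0⟩
  · have hle := hκ h0
    let s : MvPolynomial (Fin 2) k := C (μ / κ) * X 0 ^ (β - α)
    have hs : s.IsHomogeneous (β - α) := by
      simpa using (isHomogeneous_C _ (μ / κ)).mul (isHomogeneous_X_pow (R := k) (0 : Fin 2) (β - α))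
    have hsub : ∀ {F : MvPolynomial (Fin 2) k} {a : ℕ}, IsHomOf F a α → IsHomOf (s * F) a β := by
      intro F a h
      have := h.mul_left hs
      rwa [Nat.add_sub_cancel' hαβ] at this
    refine ⟨β, α, g - s • f, -f, G - s * F, -F, -κ, ⟨⟨?_, ?_, ?_⟩, fun i ↦ ?_, fun i ↦ ?_⟩,
      Or.inr ⟨rfl, rfl⟩, ?_, ?_, ?_, by simpa using h0, hle⟩
    · have := H.cross.zero
      simp only [Pi.sub_apply, Pi.neg_apply, Pi.smul_apply, smul_eq_mul]
      linear_combination this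
    · have := H.cross.one
      simp only [Pi.sub_apply, Pi.neg_apply, Pi.smul_apply, smul_eq_mul]
      linear_combination this
    · have := H.cross.two
      simp only [Pi.sub_apply, Pi.neg_apply, Pi.smul_apply, smul_eq_mul]
      linear_combination this
    · exact (H.right i).sub (hsub (H.left i))
    · exact (H.left i).neg
    · have e1 : (C (μ / κ) * C κ : MvPolynomial (Fin 2) k) = C μ := by
        rw [← C_mul, div_mul_cancel₀ _ h0]
      have e2 : (X 0 ^ (β - α) * X 0 ^ (α - e 2) : MvPolynomial (Fin 2) k) = X 0 ^ (β - e 2) := by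
        rw [← pow_add]; congr 1; omega
      simp only [Pi.sub_apply, Pi.smul_apply, smul_eq_mul, s]
      rw [hF, hG, ← e1, ← e2]
      ring
    · exact hG'.sub (hsub hF')
    · simp only [Pi.neg_apply, C_neg]
      rw [hF]; ring

end Plane

/-! ### Lengths in the plane -/

theorem length_quotient_eq_add {k A : Type*} [Field k] [CommRing A] [Algebra k A]
    {I J K : Ideal A} {t : A} (hI : I = J ⊔ Ideal.span {t}) (hK : ∀ s, t * s ∈ J ↔ s ∈ K) :
    Module.length k (A ⧸ J) = Module.length k (A ⧸ K) + Module.length k (A ⧸ I) := by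
  have hJI : J ≤ I := hI ▸ le_sup_left
  let f : (A ⧸ K) →ₗ[A] (A ⧸ J) := Submodule.mapQ K J (LinearMap.mulLeft A t)
    fun s hs ↦ (hK s).2 hs
  let g : (A ⧸ J) →ₗ[A] (A ⧸ I) := Submodule.factor hJI
  refine Module.length_eq_add_of_exact (f.restrictScalars k) (g.restrictScalars k) ?_ ?_ ?_
  · rw [injective_iff_map_eq_zero]
    intro s hs
    obtain ⟨s, rfl⟩ := Submodule.Quotient.mk_surjective K s
    exact (Submodule.Quotient.mk_eq_zero K).2 ((hK s).1 ((Submodule.Quotient.mk_eq_zero J).1 hs))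
  · exact Submodule.factor_surjective hJI
  · intro s
    obtain ⟨s, rfl⟩ := Submodule.Quotient.mk_surjective J s
    constructor
    · intro hs
      have hs : s ∈ I := (Submodule.Quotient.mk_eq_zero I).1 hs
      rw [hI] at hs
      obtain ⟨j, hj, t', ht', rfl⟩ := Submodule.mem_sup.1 hs
      obtain ⟨a, rfl⟩ := Ideal.mem_span_singleton.1 ht'
      refine ⟨Submodule.Quotient.mk a, (Submodule.Quotient.eq J).2 ?_⟩
      change t * a - (j + t * a) ∈ J
      simpa using hj
    · rintro ⟨a, ha⟩
      obtain ⟨a, rfl⟩ := Submodule.Quotient.mk_surjective K a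
      have := (Submodule.Quotient.eq J).1 ha
      refine (Submodule.Quotient.mk_eq_zero I).2 ?_
      have h2 : t * a ∈ I := hI ▸ Ideal.mul_mem_right _ _
        (Ideal.mem_sup_right (Ideal.mem_span_singleton_self t))
      have := I.sub_mem h2 (hJI this)
      simpa using this

section

variable (k : Type*) [Field k]

theorem length_quotient_X_pow_X (d : ℕ) :
    Module.length k (MvPolynomial (Fin 2) k ⧸ (Ideal.span {X 0 ^ d, X 1} :
      Ideal (MvPolynomial (Fin 2) k))) = d := by
  let K (d : ℕ) : Ideal (MvPolynomial (Fin 2) k) := Ideal.span {X 0 ^ d, X 1}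
  have hmem : ∀ (d : ℕ) (s : MvPolynomial (Fin 2) k),
      s ∈ K d ↔ ∃ a b, a * X 0 ^ d + b * X 1 = s := fun d s ↦ Ideal.mem_span_pair
  have h1 : Module.length k (MvPolynomial (Fin 2) k ⧸ K 1) = 1 := by
    have hsurj : Function.Surjective (algebraMap k (MvPolynomial (Fin 2) k ⧸ K 1)) := by
      intro s
      obtain ⟨s, rfl⟩ := Ideal.Quotient.mk_surjective s
      induction s using MvPolynomial.induction_on with
      | C c => exact ⟨c, rfl⟩
      | add s t hs ht =>
        obtain ⟨a, ha⟩ := hs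
        obtain ⟨b, hb⟩ := ht
        exact ⟨a + b, by rw [map_add, map_add, ha, hb]⟩
      | mul_X s i _ =>
        refine ⟨0, ?_⟩
        rw [map_zero, eq_comm, Ideal.Quotient.eq_zero_iff_mem]
        refine Ideal.mul_mem_left _ _ (Ideal.subset_span ?_)
        fin_cases i <;> simp
    have : Nontrivial (MvPolynomial (Fin 2) k ⧸ K 1) := by
      rw [Ideal.Quotient.nontrivial_iff, Ne, Ideal.eq_top_iff_one, hmem]
      rintro ⟨a, b, h⟩
      simpa using congr_arg (eval 0) h
    let E : k ≃ₗ[k] (MvPolynomial (Fin 2) k ⧸ K 1) :=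
      LinearEquiv.ofBijective (Algebra.linearMap k _)
        ⟨(algebraMap k (MvPolynomial (Fin 2) k ⧸ K 1)).injective, hsurj⟩
    rw [← E.length_eq, Module.length_eq_one]
  induction d with
  | zero =>
    have : K 0 = ⊤ := by
      rw [Ideal.eq_top_iff_one]; exact Ideal.subset_span (by simp)
    change Module.length k (MvPolynomial (Fin 2) k ⧸ K 0) = _
    rw [this, Nat.cast_zero, Module.length_eq_zero_iff]
    exact Ideal.Quotient.subsingleton_iff.2 rfl
  | succ d ih =>
    change Module.length k (MvPolynomial (Fin 2) k ⧸ K d) = _ at ih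
    change Module.length k (MvPolynomial (Fin 2) k ⧸ K (d + 1)) = _
    rw [length_quotient_eq_add (I := K d) (J := K (d + 1)) (K := K 1) (t := X 0 ^ d), h1, ih,
      Nat.cast_succ, add_comm]
    · refine le_antisymm ?_ (sup_le ?_ ?_)
      · rw [Ideal.span_le]
        rintro _ (rfl | rfl)
        · exact Ideal.mem_sup_right (Ideal.mem_span_singleton_self _)
        · exact Ideal.mem_sup_left (Ideal.subset_span (by simp))
      · rw [Ideal.span_le]
        rintro _ (rfl | rfl)
        · exact (hmem _ _).2 ⟨X 0, 0, by ring⟩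
        · exact Ideal.subset_span (by simp)
      · rw [Ideal.span_singleton_le_iff_mem]
        exact Ideal.subset_span (by simp)
    · intro s
      rw [hmem, hmem]
      constructor
      · rintro ⟨a, b, h⟩
        obtain ⟨c, hc⟩ := (regPair_X_pow (k := k) d 1).dvd b (s - a * X 0) (by linear_combination h)
        refine ⟨a, c, mul_left_cancel₀ (pow_ne_zero d (X_ne_zero (R := k) (0 : Fin 2))) ?_⟩
        rw [hc] at h
        linear_combination h
      · rintro ⟨a, b, rfl⟩
        exact ⟨a, X 0 ^ d * b, by ring⟩

theorem exists_isPlaneBasis (a b c : ℕ) :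
    ∃ (α β D : ℕ) (f g : Fin 3 → MvPolynomial (Fin 2) k), IsPlaneBasis ![a, b, c] α β f g ∧
      α + β = a + b + c ∧ planeLength k a b c = D ∧
      2 * D + a ^ 2 + b ^ 2 + c ^ 2 = α ^ 2 + β ^ 2 := by
  induction c with
  | zero =>
    refine ⟨a, b, 0, ![1, 0, -(X 0) ^ a], ![0, 1, -(-(X 0 + X 1)) ^ b], ⟨⟨?_, ?_, ?_⟩, ?_, ?_⟩,
      by ring, ?_, by ring⟩
    · simp [linForm]
    · simp [linForm]
    · simp [linForm]
    · intro i
      fin_cases i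
      · exact Or.inr ⟨0, by simp, isHomogeneous_one _ _⟩
      · exact Or.inl rfl
      · exact IsHomOf.neg (Or.inr ⟨a, by simp, isHomogeneous_X_pow _ _⟩)
    · intro i
      fin_cases i
      · exact Or.inl rfl
      · exact Or.inr ⟨0, by simp, isHomogeneous_one _ _⟩
      · refine IsHomOf.neg (Or.inr ⟨b, by simp, ?_⟩)
        simpa using (((isHomogeneous_X k (0 : Fin 2)).add (isHomogeneous_X k 1)).neg).pow b
    · rw [planeLength, Nat.cast_zero, Module.length_eq_zero_iff]
      refine Ideal.Quotient.subsingleton_iff.2 ?_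
      rw [Ideal.eq_top_iff_one]
      exact Ideal.subset_span (by simp)
  | succ c ih =>
    obtain ⟨α, β, D, f, g, H, hsum, hD, hq⟩ := ih
    obtain ⟨α', β', f', g', F, G, κ, H', hαβ, hf, hF, hg, hκ, hβ⟩ := H.exists_normalized
    have e2 : (![a, b, c] : Fin 3 → ℕ) 2 = c := rfl
    rw [e2] at hF hg hβ
    refine ⟨α', β' + 1, D + (β' - c), ![f' 0, f' 1, F], ![X 1 * g' 0, X 1 * g' 1, g' 2],
      ⟨⟨?_, ?_, ?_⟩, ?_, ?_⟩, by omega, ?_, ?_⟩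
    · have := H'.cross.zero
      simp [linForm] at this ⊢
      linear_combination this + g' 1 * hf
    · have := H'.cross.one
      simp [linForm] at this ⊢
      linear_combination this - g' 0 * hf
    · have := H'.cross.two
      simp [linForm] at this ⊢
      linear_combination X 1 * this
    · intro i
      fin_cases i
      · exact H'.left 0
      · exact H'.left 1
      · exact hF
    · intro i
      fin_cases i
      · exact (H'.right 0).mul_left (isHomogeneous_X _ _)
      · exact (H'.right 1).mul_left (isHomogeneous_X _ _)
      · exact (H'.right 2).succ
    · have hmem : ∀ (m : ℕ) (s : MvPolynomial (Fin 2) k),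
          s ∈ Ideal.span {linForm k 0 ^ a, linForm k 1 ^ b, linForm k 2 ^ m} ↔
            ∃ x y z, s = x * linForm k 0 ^ a + y * linForm k 1 ^ b + z * linForm k 2 ^ m := by
        intro m s
        rw [Submodule.mem_span_triple]
        simp only [smul_eq_mul, eq_comm]
      rw [planeLength, length_quotient_eq_add (K := Ideal.span {X 0 ^ (β' - c), X 1})
        (I := Ideal.span {linForm k 0 ^ a, linForm k 1 ^ b, linForm k 2 ^ c})
        (t := linForm k 2 ^ c), length_quotient_X_pow_X]
      · rw [planeLength] at hD
        rw [hD, Nat.cast_add, add_comm]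
      · refine le_antisymm ?_ (sup_le ?_ ?_)
        · rw [Ideal.span_le]
          rintro _ (rfl | rfl | rfl)
          · exact Ideal.mem_sup_left (Ideal.subset_span (by simp))
          · exact Ideal.mem_sup_left (Ideal.subset_span (by simp))
          · exact Ideal.mem_sup_right (Ideal.mem_span_singleton_self _)
        · rw [Ideal.span_le]
          rintro _ (rfl | rfl | rfl)
          · exact Ideal.subset_span (by simp)
          · exact Ideal.subset_span (by simp)
          · exact (hmem _ _).2 ⟨0, 0, linForm k 2, by ring⟩
        · rw [Ideal.span_singleton_le_iff_mem]
          exact Ideal.subset_span (by simp)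
      · intro s
        rw [hmem, Ideal.mem_span_pair]
        constructor
        · rintro ⟨x, y, z, h⟩
          obtain ⟨m, m', hm, -⟩ := H'.cross.exists_eq_add
            (by simpa [linForm] using regPair_X_pow a c)
            (s := ![x, y, z * X 1 - s]) (by simp [linForm] at h ⊢; linear_combination -h)
          have := hm 2
          rw [hf, hg] at this
          simp at this
          exact ⟨-m' * C κ, z - m * F - m' * G, by linear_combination this⟩
        · rintro ⟨m, m', rfl⟩
          have h1 := H'.cross.dot_right
          rw [hg] at h1
          simp [linForm] at h1 ⊢
          have hC : C κ⁻¹ * C κ = (1 : MvPolynomial (Fin 2) k) := by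
            rw [← C_mul, inv_mul_cancel₀ hκ, C_1]
          refine ⟨-m * C κ⁻¹ * g' 0, -m * C κ⁻¹ * g' 1, m' - m * C κ⁻¹ * G, ?_⟩
          linear_combination m * C κ⁻¹ * h1 - m * X 0 ^ (β' - c) * X 1 ^ c * hC
    · obtain ⟨d, rfl⟩ := Nat.exists_eq_add_of_le hβ
      rw [Nat.add_sub_cancel_left]
      rcases hαβ with ⟨rfl, rfl⟩ | ⟨rfl, rfl⟩ <;> nlinarith
end

/-! ### The three linear forms -/

theorem Fin.sum_univ_three_cyclic {M : Type*} [AddCommMonoid M] (F : Fin 3 → M) (i : Fin 3) :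
    ∑ j, F j = F i + F (i + 1) + F (i + 2) := by
  rw [Fin.sum_univ_three]
  fin_cases i
  · rfl
  · simp only [Fin.mk_one]; rw [add_comm (F 1 + _), add_assoc]; rfl
  · simp only [Fin.reduceFinMk]; rw [add_comm (F 0 + F 1), ← add_assoc]; rfl

theorem Fin.eq_or_eq_add_one_or_eq_add_two (i j : Fin 3) : j = i ∨ j = i + 1 ∨ j = i + 2 := by
  revert i j; decide

theorem isCross_iff {R : Type*} [CommRing R] {f g h : Fin 3 → R} :
    IsCross f g h ↔ ∀ i, f (i + 1) * g (i + 2) - f (i + 2) * g (i + 1) = h i := by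
  constructor
  · intro H i
    fin_cases i
    · exact H.zero
    · exact H.one
    · exact H.two
  · intro H
    exact ⟨H 0, H 1, H 2⟩

section LinForm

variable (k : Type*) [Field k]

theorem isHomogeneous_linForm (i : Fin 3) : (linForm k i).IsHomogeneous 1 := by
  fin_cases i
  · exact isHomogeneous_X k 0
  · exact ((isHomogeneous_X k (0 : Fin 2)).add (isHomogeneous_X k 1)).neg
  · exact isHomogeneous_X k 1

theorem exists_eval_linForm (i : Fin 3) :
    ∃ P : Fin 2 → k, eval P (linForm k i) = 0 ∧ ∀ j, j ≠ i → eval P (linForm k j) ≠ 0 := by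
  fin_cases i
  · refine ⟨![0, 1], by simp [linForm], fun j hj ↦ ?_⟩
    fin_cases j <;> simp [linForm] at hj ⊢
  · refine ⟨![1, -1], by simp [linForm], fun j hj ↦ ?_⟩
    fin_cases j <;> simp [linForm] at hj ⊢
  · refine ⟨![1, 0], by simp [linForm], fun j hj ↦ ?_⟩
    fin_cases j <;> simp [linForm] at hj ⊢

theorem linForm_ne_zero (i : Fin 3) : linForm k i ≠ 0 := by
  obtain ⟨P, -, hP⟩ := exists_eval_linForm k (i + 1)
  intro h
  refine hP i (by fin_cases i <;> decide) ?_
  rw [h, map_zero]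

theorem totalDegree_linForm (i : Fin 3) : (linForm k i).totalDegree = 1 :=
  (isHomogeneous_linForm k i).totalDegree (linForm_ne_zero k i)

theorem prime_linForm (i : Fin 3) : Prime (linForm k i) := by
  refine (irreducible_of_totalDegree_eq_one (totalDegree_linForm k i) fun x hx ↦ ?_).prime
  obtain ⟨m, hm⟩ := ne_zero_iff.1 (linForm_ne_zero k i)
  refine isUnit_iff_ne_zero.2 ?_
  rintro rfl
  exact hm (zero_dvd_iff.1 (hx m))

variable {k}

theorem linForm_dvd_linForm {i j : Fin 3} (h : linForm k i ∣ linForm k j) : j = i := by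
  obtain ⟨P, hP, hP'⟩ := exists_eval_linForm k i
  by_contra hne
  obtain ⟨c, hc⟩ := h
  refine hP' j hne ?_
  rw [hc, map_mul, hP, zero_mul]

theorem totalDegree_linForm_pow (i : Fin 3) (m : ℕ) : (linForm k i ^ m).totalDegree = m := by
  simpa using ((isHomogeneous_linForm k i).pow m).totalDegree (pow_ne_zero m (linForm_ne_zero k i))

theorem totalDegree_linForm_mul (i : Fin 3) {F : MvPolynomial (Fin 2) k} (hF : F ≠ 0) :
    (linForm k i * F).totalDegree = F.totalDegree + 1 := by
  rw [totalDegree_mul_of_isDomain (linForm_ne_zero k i) hF, totalDegree_linForm, add_comm]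

theorem totalDegree_pos_of_prime {F : MvPolynomial (Fin 2) k} (hF : Prime F) :
    0 < F.totalDegree := by
  by_contra h
  rw [not_lt, Nat.le_zero, totalDegree_eq_zero_iff_eq_C] at h
  refine hF.not_isUnit ?_
  rw [h]
  refine (isUnit_iff_ne_zero.2 fun h0 ↦ hF.ne_zero ?_).map C
  rw [h, h0, C_0]

end LinForm

/-! ### Destabilizing syzygies -/

/-- The amount by which a syzygy of degree `α` of `u ^ a 0, v ^ a 1, w ^ a 2` destabilizes the
syzygy bundle of `x ^ q, y ^ q, z ^ q`. -/
def score (n q : ℕ) (a : Fin 3 → ℕ) (α : ℕ) : ℤ :=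
  ∑ i, ((n : ℤ) * a i - |(n : ℤ) * a i - q|) - 2 * n * α

/-- `f` is a syzygy of `u ^ a 0, v ^ a 1, w ^ a 2` of degree at most `α`, with nonzero entries. -/
structure IsSyzygy {k : Type*} [Field k] (a : Fin 3 → ℕ) (α : ℕ)
    (f : Fin 3 → MvPolynomial (Fin 2) k) : Prop where
  ne_zero : ∀ i, f i ≠ 0
  sum_eq_zero : ∑ i, f i * linForm k i ^ a i = 0
  degree_le : ∀ i, (f i).totalDegree + a i ≤ α

section Destabilizing

variable {k : Type*} [Field k] {n q α : ℕ} {a : Fin 3 → ℕ} {f : Fin 3 → MvPolynomial (Fin 2) k}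

theorem IsSyzygy.of_score_pos (h0 : f ≠ 0) (hsum : ∑ i, f i * linForm k i ^ a i = 0)
    (hdeg : ∀ i, f i ≠ 0 → (f i).totalDegree + a i ≤ α) (hs : 0 < score n q a α) :
    IsSyzygy a α f := by
  suffices hne : ∀ i, f i ≠ 0 from ⟨hne, hsum, fun i ↦ hdeg i (hne i)⟩
  intro i hi
  rw [Fin.sum_univ_three_cyclic _ i, hi, zero_mul, zero_add] at hsum
  have hij : i + 1 ≠ i + 2 := by fin_cases i <;> decide
  have h1 : f (i + 1) ≠ 0 := by
    intro h1
    rw [h1, zero_mul, zero_add, mul_eq_zero] at hsum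
    have h2 := hsum.resolve_right (pow_ne_zero _ (linForm_ne_zero k _))
    refine h0 (funext fun j ↦ ?_)
    rcases Fin.eq_or_eq_add_one_or_eq_add_two i j with rfl | rfl | rfl <;> assumption
  have hdvd : linForm k (i + 2) ^ a (i + 2) ∣ f (i + 1) := by
    refine (prime_linForm k _).pow_dvd_of_dvd_mul_right _
      (fun h ↦ hij (linForm_dvd_linForm ((prime_linForm k (i + 2)).dvd_of_dvd_pow h)))
      (⟨-f (i + 2), by linear_combination hsum⟩ :
        _ ∣ f (i + 1) * linForm k (i + 1) ^ a (i + 1))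
  have h3 := totalDegree_le_of_dvd_of_isDomain hdvd h1
  rw [totalDegree_linForm_pow] at h3
  have h4 := hdeg _ h1
  rw [score, Fin.sum_univ_three_cyclic _ i] at hs
  have h5 : (n : ℤ) * (a (i + 1) + a (i + 2)) ≤ n * α := by
    refine mul_le_mul_of_nonneg_left ?_ (by positivity)
    exact_mod_cast (by omega : a (i + 1) + a (i + 2) ≤ α)
  have h6 := le_abs_self ((n : ℤ) * a i - q)
  have h6' := neg_abs_le ((n : ℤ) * a i - q)
  have h7 := neg_abs_le ((n : ℤ) * a (i + 1) - q)
  have h8 := abs_nonneg ((n : ℤ) * a (i + 2) - q)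
  have h9 : (0 : ℤ) ≤ n * a (i + 2) := by positivity
  linarith

theorem score_update_succ (i : Fin 3) :
    score n q a α ≤ score n q (Function.update a i (a i + 1)) α := by
  have h1 : i + 1 ≠ i := by fin_cases i <;> decide
  have h2 : i + 2 ≠ i := by fin_cases i <;> decide
  rw [score, score, Fin.sum_univ_three_cyclic _ i, Fin.sum_univ_three_cyclic _ i]
  simp only [Function.update_self, Function.update_of_ne h1, Function.update_of_ne h2]
  have := abs_sub_abs_le_abs_sub ((n : ℤ) * (a i + 1 : ℕ) - q) ((n : ℤ) * a i - q)
  have e : (n : ℤ) * (a i + 1 : ℕ) - q - ((n : ℤ) * a i - q) = n := by push_cast; ring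
  rw [e, Nat.abs_cast] at this
  push_cast at this ⊢
  linarith

theorem score_update_pred {i : Fin 3} {b β : ℕ} (hb : a i = b + 1) (hβ : α = β + 1) :
    score n q a α ≤ score n q (Function.update a i b) β := by
  have h1 : i + 1 ≠ i := by fin_cases i <;> decide
  have h2 : i + 2 ≠ i := by fin_cases i <;> decide
  rw [score, score, Fin.sum_univ_three_cyclic _ i, Fin.sum_univ_three_cyclic _ i]
  simp only [Function.update_self, Function.update_of_ne h1, Function.update_of_ne h2]
  have := abs_sub_abs_le_abs_sub ((n : ℤ) * b - q) ((n : ℤ) * a i - q)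
  have e : (n : ℤ) * b - q - ((n : ℤ) * a i - q) = -n := by rw [hb]; push_cast; ring
  rw [e, abs_neg, Nat.abs_cast] at this
  rw [hb, hβ] at *
  push_cast at this ⊢
  linarith

/-- A syzygy whose entries allow none of the obvious simplifications. -/
structure IsReducedSyzygy (a : Fin 3 → ℕ) (α : ℕ) (f : Fin 3 → MvPolynomial (Fin 2) k) : Prop
    extends IsSyzygy a α f where
  not_dvd : ∀ π, Prime π → ∃ i, ¬ π ∣ f i
  not_dvd_self : ∀ i, ¬ linForm k i ∣ f i
  not_dvd_others : ∀ i, linForm k i ∣ f (i + 1) → ¬ linForm k i ∣ f (i + 2)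

theorem IsSyzygy.exists_reduced (H : IsSyzygy a α f) (hs : 0 < score n q a α) :
    ∃ (a : Fin 3 → ℕ) (α : ℕ) (f : Fin 3 → MvPolynomial (Fin 2) k),
      IsReducedSyzygy a α f ∧ 0 < score n q a α := by
  induction hN : ∑ i, (f i).totalDegree using Nat.strong_induction_on generalizing a α f with
  | _ N ih =>
  subst hN
  by_cases hR : IsReducedSyzygy a α f
  · exact ⟨a, α, f, hR, hs⟩
  have key : ∀ {a' α'} {f' : Fin 3 → MvPolynomial (Fin 2) k}, IsSyzygy a' α' f' →
      0 < score n q a' α' → ∑ i, (f' i).totalDegree < ∑ i, (f i).totalDegree →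
      ∃ (a : Fin 3 → ℕ) (α : ℕ) (f : Fin 3 → MvPolynomial (Fin 2) k),
        IsReducedSyzygy a α f ∧ 0 < score n q a α :=
    fun h1 h2 h3 ↦ ih _ h3 h1 h2 rfl
  have hcommon : ∀ π, Prime π → (∀ i, π ∣ f i) → ∃ (a : Fin 3 → ℕ) (α : ℕ)
      (f : Fin 3 → MvPolynomial (Fin 2) k), IsReducedSyzygy a α f ∧ 0 < score n q a α := by
    intro π hπ hdvd
    choose f' hf' using hdvd
    have hne : ∀ i, f' i ≠ 0 := fun i h ↦ H.ne_zero i (by rw [hf', h, mul_zero])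
    have hdeg : ∀ i, (f i).totalDegree = π.totalDegree + (f' i).totalDegree := fun i ↦ by
      rw [hf', totalDegree_mul_of_isDomain hπ.ne_zero (hne i)]
    have hpos := totalDegree_pos_of_prime hπ
    refine key (a' := a) (α' := α) (f' := f') ⟨hne, ?_, fun i ↦ ?_⟩ hs ?_
    · refine (mul_eq_zero.1 ?_).resolve_left hπ.ne_zero
      rw [Finset.mul_sum, ← H.sum_eq_zero]
      exact Finset.sum_congr rfl fun i _ ↦ by rw [hf' i]; ring
    · have := H.degree_le i
      have := hdeg i
      omega
    · exact Finset.sum_lt_sum_of_nonempty Finset.univ_nonempty fun i _ ↦ by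
        have := hdeg i
        omega
  have hself : ∀ i, linForm k i ∣ f i → ∃ (a : Fin 3 → ℕ) (α : ℕ)
      (f : Fin 3 → MvPolynomial (Fin 2) k), IsReducedSyzygy a α f ∧ 0 < score n q a α := by
    rintro i ⟨F, hF⟩
    have h1 : i + 1 ≠ i := by fin_cases i <;> decide
    have h2 : i + 2 ≠ i := by fin_cases i <;> decide
    have hF0 : F ≠ 0 := by
      rintro rfl
      exact H.ne_zero i (by rw [hF, mul_zero])
    have hd : (f i).totalDegree = F.totalDegree + 1 := by rw [hF, totalDegree_linForm_mul i hF0]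
    refine key (a' := Function.update a i (a i + 1)) (α' := α) (f' := Function.update f i F)
      ⟨fun j ↦ ?_, ?_, fun j ↦ ?_⟩ (hs.trans_le (score_update_succ i)) ?_
    · rcases eq_or_ne j i with rfl | hj
      · rwa [Function.update_self]
      · rw [Function.update_of_ne hj]; exact H.ne_zero j
    · have := H.sum_eq_zero
      rw [Fin.sum_univ_three_cyclic _ i] at this ⊢
      simp only [Function.update_self, Function.update_of_ne h1, Function.update_of_ne h2]
      rw [← this, hF]
      ring
    · have := H.degree_le j
      rcases eq_or_ne j i with rfl | hj
      · rw [Function.update_self, Function.update_self]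
        omega
      · rwa [Function.update_of_ne hj, Function.update_of_ne hj]
    · rw [Fin.sum_univ_three_cyclic _ i, Fin.sum_univ_three_cyclic _ i]
      simp only [Function.update_self, Function.update_of_ne h1, Function.update_of_ne h2]
      omega
  have hothers : ∀ i, linForm k i ∣ f (i + 1) → linForm k i ∣ f (i + 2) → ∃ (a : Fin 3 → ℕ) (α : ℕ)
      (f : Fin 3 → MvPolynomial (Fin 2) k), IsReducedSyzygy a α f ∧ 0 < score n q a α := by
    intro i hF hG
    have h1 : i + 1 ≠ i := by fin_cases i <;> decide
    have h2 : i + 2 ≠ i := by fin_cases i <;> decide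
    have h12 : i + 1 ≠ i + 2 := by fin_cases i <;> decide
    have hsum := H.sum_eq_zero
    rw [Fin.sum_univ_three_cyclic _ i] at hsum
    rcases hai : a i with _ | b
    · refine hself i ?_
      rw [hai, pow_zero, mul_one, add_assoc] at hsum
      rw [eq_neg_of_add_eq_zero_left hsum, dvd_neg]
      exact dvd_add (hF.mul_right _) (hG.mul_right _)
    obtain ⟨F, hF⟩ := hF
    obtain ⟨G, hG⟩ := hG
    have hF0 : F ≠ 0 := by
      rintro rfl
      exact H.ne_zero (i + 1) (by rw [hF, mul_zero])
    have hG0 : G ≠ 0 := by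
      rintro rfl
      exact H.ne_zero (i + 2) (by rw [hG, mul_zero])
    have hdF : (f (i + 1)).totalDegree = F.totalDegree + 1 := by
      rw [hF, totalDegree_linForm_mul i hF0]
    have hdG : (f (i + 2)).totalDegree = G.totalDegree + 1 := by
      rw [hG, totalDegree_linForm_mul i hG0]
    obtain ⟨β, rfl⟩ : ∃ β, α = β + 1 := ⟨α - 1, by have := H.degree_le (i + 1); omega⟩
    refine key (a' := Function.update a i b) (α' := β)
      (f' := Function.update (Function.update f (i + 1) F) (i + 2) G)
      ⟨fun j ↦ ?_, ?_, fun j ↦ ?_⟩ (hs.trans_le (score_update_pred hai rfl)) ?_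
    · rcases Fin.eq_or_eq_add_one_or_eq_add_two i j with rfl | rfl | rfl
      · rw [Function.update_of_ne h2.symm, Function.update_of_ne h1.symm]; exact H.ne_zero j
      · rwa [Function.update_of_ne h12, Function.update_self]
      · rwa [Function.update_self]
    · rw [Fin.sum_univ_three_cyclic _ i]
      simp only [Function.update_self, Function.update_of_ne h1, Function.update_of_ne h2,
        Function.update_of_ne h12, Function.update_of_ne h2.symm, Function.update_of_ne h1.symm]
      refine (mul_eq_zero.1 ?_).resolve_left (linForm_ne_zero k i)
      rw [← hsum, hF, hG, hai]
      ring
    · have := H.degree_le j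
      rcases Fin.eq_or_eq_add_one_or_eq_add_two i j with rfl | rfl | rfl
      · rw [Function.update_of_ne h2.symm, Function.update_of_ne h1.symm, Function.update_self]
        omega
      · rw [Function.update_of_ne h12, Function.update_self, Function.update_of_ne h1]
        omega
      · rw [Function.update_self, Function.update_of_ne h2]
        omega
    · rw [Fin.sum_univ_three_cyclic _ i, Fin.sum_univ_three_cyclic _ i]
      simp only [Function.update_self, Function.update_of_ne h12, Function.update_of_ne h2.symm,
        Function.update_of_ne h1.symm]
      omega
  by_contra hcon
  refine hR ⟨H, fun π hπ ↦ ?_, fun i h ↦ hcon (hself i h), fun i h h' ↦ hcon (hothers i h h')⟩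
  by_contra! h
  exact hcon (hcommon π hπ h)

/-- The Frobenius pull-back of a reduced syzygy. -/
theorem IsReducedSyzygy.frobenius (H : IsReducedSyzygy a α f) (p : ℕ) [Fact p.Prime] [CharP k p]
    (j : ℕ) : IsReducedSyzygy (fun i ↦ p ^ j * a i) (p ^ j * α) (fun i ↦ f i ^ p ^ j) where
  ne_zero i := pow_ne_zero _ (H.ne_zero i)
  sum_eq_zero := by
    have := congr_arg (· ^ p ^ j) H.sum_eq_zero
    simp only [sum_pow_char_pow, zero_pow (pow_ne_zero j (Fact.out : p.Prime).ne_zero)] at this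
    rw [← this]
    refine Finset.sum_congr rfl fun i _ ↦ ?_
    rw [mul_pow, ← pow_mul, mul_comm (a i)]
  degree_le i := by
    have h1 := totalDegree_pow (f i) (p ^ j)
    have h2 := Nat.mul_le_mul_left (p ^ j) (H.degree_le i)
    rw [mul_add] at h2
    omega
  not_dvd π hπ := by
    obtain ⟨i, hi⟩ := H.not_dvd π hπ
    exact ⟨i, fun h ↦ hi (hπ.dvd_of_dvd_pow h)⟩
  not_dvd_self i h := H.not_dvd_self i ((prime_linForm k i).dvd_of_dvd_pow h)
  not_dvd_others i h h' := H.not_dvd_others i ((prime_linForm k i).dvd_of_dvd_pow h)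
    ((prime_linForm k i).dvd_of_dvd_pow h')

theorem score_mul (N : ℕ) : score n (N * q) (fun i ↦ N * a i) (N * α) = N * score n q a α := by
  simp only [score, mul_sub, Finset.mul_sum]
  congr 1
  · refine Finset.sum_congr rfl fun i _ ↦ ?_
    have e : (n : ℤ) * (N * a i : ℕ) - (N * q : ℕ) = N * (n * a i - q) := by push_cast; ring
    rw [e, abs_mul, Nat.abs_cast]
    push_cast
    ring
  · push_cast; ring

end Destabilizing

/-! ### From destabilizing syzygies to free syzygy modules -/

/-- Rounding `a` to one of the two integers `m` near `Q / n`, with the exponents needed to correct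
the error in the Fermat ring. -/
theorem exists_rounding {n : ℕ} (hn : 0 < n) (Q a : ℕ) :
    ∃ m s t S T S' T' : ℕ, a + t = m + s ∧ (s = 0 ∨ t = 0) ∧ t ≤ m ∧ S + T' = n * s ∧
      T + S' = n * t ∧ T + T' + n * (m - t) = Q ∧
      (n : ℤ) * (s + t) ≤ |(n : ℤ) * a - Q| + n := by
  have hQ := Nat.div_add_mod Q n
  have hr := Nat.mod_lt Q hn
  set θ := Q / n
  set r := Q % n
  rcases Nat.lt_or_ge θ a with h | h
  · obtain ⟨s, rfl⟩ := Nat.exists_eq_add_of_lt h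
    refine ⟨θ, s + 1, 0, n * (s + 1) - r, 0, 0, r, by ring, Or.inr rfl, Nat.zero_le _, ?_, by simp,
      ?_, ?_⟩
    · have : n * 1 ≤ n * (s + 1) := Nat.mul_le_mul_left n (by omega)
      omega
    · rw [Nat.sub_zero]; omega
    · have := le_abs_self ((n : ℤ) * (θ + s + 1 : ℕ) - Q)
      rw [← hQ] at this ⊢
      push_cast at this ⊢
      linarith
  · obtain ⟨t, hθ⟩ := Nat.exists_eq_add_of_le h
    refine ⟨θ + 1, 0, t + 1, 0, n * t + r, n - r, 0, by omega, Or.inl rfl, by omega, by simp, ?_,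
      ?_, ?_⟩
    · rw [mul_add]; omega
    · have : θ + 1 - (t + 1) = a := by omega
      rw [this, ← hQ, hθ]; ring
    · have := neg_abs_le ((n : ℤ) * a - Q)
      rw [← hQ, hθ] at this ⊢
      push_cast at this ⊢
      linarith

section Cross

variable {k : Type*} [Field k]

theorem degree_add_le_of_isCross {m : Fin 3 → ℕ} {α β : ℕ} {c : MvPolynomial (Fin 2) k}
    {f g : Fin 3 → MvPolynomial (Fin 2) k} (H : IsCross f g (c • fun i ↦ linForm k i ^ m i))
    (hc : c ≠ 0) (hf : ∀ i, f i ≠ 0 → (f i).totalDegree + m i ≤ α)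
    (hg : ∀ i, g i ≠ 0 → (g i).totalDegree + m i ≤ β) : m 0 + m 1 + m 2 ≤ α + β := by
  have h := H.zero
  simp only [Pi.smul_apply, smul_eq_mul] at h
  have hne : c * linForm k 0 ^ m 0 ≠ 0 := mul_ne_zero hc (pow_ne_zero _ (linForm_ne_zero k 0))
  have hdeg : m 0 ≤ (c * linForm k 0 ^ m 0).totalDegree := by
    rw [totalDegree_mul_of_isDomain hc (pow_ne_zero _ (linForm_ne_zero k 0)),
      totalDegree_linForm_pow]
    omega
  rw [← h] at hdeg hne
  have hmul : ∀ i j, f i * g j ≠ 0 → (f i * g j).totalDegree + m i + m j ≤ α + β := by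
    intro i j hij
    have := totalDegree_mul (f i) (g j)
    have := hf i (left_ne_zero_of_mul hij)
    have := hg j (right_ne_zero_of_mul hij)
    omega
  by_cases h1 : f 1 * g 2 = 0
  · rw [h1, zero_sub] at hne hdeg
    rw [totalDegree_neg] at hdeg
    have := hmul 2 1 (neg_ne_zero.1 hne)
    omega
  by_cases h2 : f 2 * g 1 = 0
  · rw [h2, sub_zero] at hdeg
    have := hmul 1 2 h1
    omega
  have := hmul 1 2 h1
  have := hmul 2 1 h2
  have := totalDegree_sub (f 1 * g 2) (f 2 * g 1)
  omega

theorem regPair_linForm_pow (m : Fin 3 → ℕ) :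
    RegPair ((fun i ↦ linForm k i ^ m i) 0) ((fun i ↦ linForm k i ^ m i) 2) := by
  simpa [linForm] using regPair_X_pow (k := k) (m 0) (m 2)

/-- A syzygy of small degree without common factors is part of a basis. -/
theorem exists_isCross_of_degree_lt {m : Fin 3 → ℕ} {α : ℕ} {f : Fin 3 → MvPolynomial (Fin 2) k}
    (hsum : ∑ i, f i * linForm k i ^ m i = 0)
    (hdeg : ∀ i, f i ≠ 0 → (f i).totalDegree + m i ≤ α) (hα : 2 * α < m 0 + m 1 + m 2)
    (hdvd : ∀ π, Prime π → ∃ i, ¬ π ∣ f i) :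
    ∃ g, IsCross f g fun i ↦ linForm k i ^ m i := by
  obtain ⟨α₀, β₀, f₀, g₀, H, hle, hsum₀⟩ : ∃ (α₀ β₀ : ℕ) (f₀ g₀ : Fin 3 → MvPolynomial (Fin 2) k),
      IsPlaneBasis m α₀ β₀ f₀ g₀ ∧ α₀ ≤ β₀ ∧ α₀ + β₀ = m 0 + m 1 + m 2 := by
    obtain ⟨α₀, β₀, -, f₀, g₀, H, hsum₀, -⟩ := exists_isPlaneBasis k (m 0) (m 1) (m 2)
    have hm : ![m 0, m 1, m 2] = m := by ext i; fin_cases i <;> rfl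
    rw [hm] at H
    rcases le_total α₀ β₀ with h | h
    · exact ⟨α₀, β₀, f₀, g₀, H, h, hsum₀⟩
    · exact ⟨β₀, α₀, g₀, -f₀, H.swap, h, by omega⟩
  rw [Fin.sum_univ_three] at hsum
  obtain ⟨c, c', hf, hc'⟩ := H.cross.exists_eq_add (regPair_linForm_pow m) hsum
  have hc'0 : c' = 0 := by
    by_contra h0
    have := degree_add_le_of_isCross hc' h0 (fun i ↦ (H.left i).totalDegree_le) hdeg
    omega
  simp only [hc'0, zero_mul, add_zero] at hf
  have hc : IsUnit c := by
    by_contra hc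
    have hc0 : c ≠ 0 := by
      rintro rfl
      obtain ⟨i, hi⟩ := hdvd _ (prime_linForm k 0)
      exact hi (by rw [hf i, zero_mul]; exact dvd_zero _)
    obtain ⟨π, hπ, hπc⟩ := WfDvdMonoid.exists_irreducible_factor hc hc0
    obtain ⟨i, hi⟩ := hdvd π hπ.prime
    exact hi (by rw [hf i]; exact hπc.mul_right _)
  obtain ⟨d, hd⟩ := hc.exists_right_inv
  refine ⟨d • g₀, isCross_iff.2 fun i ↦ ?_⟩
  have := isCross_iff.1 H.cross i
  simp only [Pi.smul_apply, smul_eq_mul, hf]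
  linear_combination (c * d) * this + linForm k i ^ m i * hd

/-- A reduced syzygy of large score yields a Hilbert–Burch basis in the Fermat ring. -/
theorem IsReducedSyzygy.exists_isCross {n Q α : ℕ} {a : Fin 3 → ℕ}
    {f : Fin 3 → MvPolynomial (Fin 2) k} (H : IsReducedSyzygy a α f) (hn : 0 < n)
    (hs : 3 * (n : ℤ) < score n Q a α) {R : Type*} [CommRing R] [Algebra k R]
    (φ : MvPolynomial (Fin 2) k →ₐ[k] R) (x : Fin 3 → R) (hφ : ∀ i, φ (linForm k i) = x i ^ n) :
    ∃ F G, IsCross F G fun i ↦ x i ^ Q := by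
  choose m s t S T S' T' ham hst htm hS hT hQ hbound using fun i ↦ exists_rounding hn Q (a i)
  let ℓ := linForm k
  have hℓ : ∀ i, Prime (ℓ i) := prime_linForm k
  let F : Fin 3 → MvPolynomial (Fin 2) k := fun i ↦
    f i * (ℓ i ^ s i * (ℓ (i + 1) ^ t (i + 1) * ℓ (i + 2) ^ t (i + 2)))
  have i11 : ∀ i : Fin 3, i + 1 + 1 = i + 2 := by decide
  have i12 : ∀ i : Fin 3, i + 1 + 2 = i := by decide
  have i21 : ∀ i : Fin 3, i + 2 + 1 = i := by decide
  have i22 : ∀ i : Fin 3, i + 2 + 2 = i + 1 := by decide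
  obtain ⟨g, hg⟩ : ∃ g, IsCross F g fun i ↦ ℓ i ^ m i := by
    refine exists_isCross_of_degree_lt (α := α + ∑ i, t i) ?_ (fun i _ ↦ ?_) ?_ fun π hπ ↦ ?_
    · have : ∀ i, F i * ℓ i ^ m i = (∏ j, ℓ j ^ t j) * (f i * ℓ i ^ a i) := by
        intro i
        have e : (∏ j, ℓ j ^ t j) = ℓ i ^ t i * (ℓ (i + 1) ^ t (i + 1) * ℓ (i + 2) ^ t (i + 2)) := by
          rw [Fin.prod_univ_three]
          fin_cases i
          · exact mul_assoc _ _ _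
          · simp only [Fin.mk_one, Fin.reduceAdd]; ring
          · simp only [Fin.reduceFinMk, Fin.reduceAdd]; ring
        have e' : ℓ i ^ s i * ℓ i ^ m i = ℓ i ^ t i * ℓ i ^ a i := by
          rw [← pow_add, ← pow_add, add_comm, ← ham, add_comm]
        rw [e]
        simp only [F]
        linear_combination f i * (ℓ (i + 1) ^ t (i + 1) * ℓ (i + 2) ^ t (i + 2)) * e'
      change ∑ i, F i * ℓ i ^ m i = 0
      rw [Finset.sum_congr rfl fun i _ ↦ this i, ← Finset.mul_sum, H.sum_eq_zero, mul_zero]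
    · have h1 := totalDegree_mul (f i) (ℓ i ^ s i * (ℓ (i + 1) ^ t (i + 1) * ℓ (i + 2) ^ t (i + 2)))
      have h2 := totalDegree_mul (ℓ i ^ s i) (ℓ (i + 1) ^ t (i + 1) * ℓ (i + 2) ^ t (i + 2))
      have h3 := totalDegree_mul (ℓ (i + 1) ^ t (i + 1)) (ℓ (i + 2) ^ t (i + 2))
      rw [totalDegree_linForm_pow, totalDegree_linForm_pow] at h3
      rw [totalDegree_linForm_pow] at h2
      have h4 := H.degree_le i
      have h5 := ham i
      rw [Fin.sum_univ_three_cyclic _ i]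
      simp only [F]
      omega
    · rw [score, Fin.sum_univ_three] at hs
      have b0 := hbound 0
      have b1 := hbound 1
      have b2 := hbound 2
      have e0 : (a 0 : ℤ) = m 0 + s 0 - t 0 := by have := ham 0; omega
      have e1 : (a 1 : ℤ) = m 1 + s 1 - t 1 := by have := ham 1; omega
      have e2 : (a 2 : ℤ) = m 2 + s 2 - t 2 := by have := ham 2; omega
      rw [Fin.sum_univ_three]
      have hpos : (0 : ℤ) < n * (m 0 + m 1 + m 2 - 2 * (α + (t 0 + t 1 + t 2))) := by
        have e : (n : ℤ) * (m 0 + m 1 + m 2 - 2 * (α + (t 0 + t 1 + t 2))) =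
            n * a 0 + n * a 1 + n * a 2 - 2 * n * α -
              (n * (s 0 + t 0) + n * (s 1 + t 1) + n * (s 2 + t 2)) := by
          rw [e0, e1, e2]; ring
        linarith
      have := pos_of_mul_pos_right hpos (by positivity)
      zify
      linarith
    · by_contra! hdvd
      by_cases hπℓ : ∃ i, π ∣ ℓ i
      · obtain ⟨i, hi⟩ := hπℓ
        have hassoc : Associated π (ℓ i) := hπ.associated_of_dvd (hℓ i) hi
        have hne : ∀ j, j ≠ i → ¬ π ∣ ℓ j := fun j hj h ↦
          hj (linForm_dvd_linForm (hassoc.dvd_iff_dvd_left.1 h))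
        have h1 : i + 1 ≠ i := by fin_cases i <;> decide
        have h2 : i + 2 ≠ i := by fin_cases i <;> decide
        have hpow : ∀ j e, j ≠ i → ¬ π ∣ ℓ j ^ e := fun j e hj h ↦ hne j hj (hπ.dvd_of_dvd_pow h)
        rcases hst i with h | h
        · refine H.not_dvd_self i (hassoc.dvd_iff_dvd_left.1 ?_)
          have := hdvd i
          simp only [F, h, pow_zero, one_mul] at this
          refine (hπ.dvd_or_dvd this).resolve_right fun h' ↦ ?_
          rcases hπ.dvd_or_dvd h' with h' | h'
          · exact hpow _ _ h1 h'
          · exact hpow _ _ h2 h'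
        · refine H.not_dvd_others i (hassoc.dvd_iff_dvd_left.1 ?_) (hassoc.dvd_iff_dvd_left.1 ?_)
          · have := hdvd (i + 1)
            simp only [F, i11, i12, h, pow_zero, mul_one] at this
            refine (hπ.dvd_or_dvd this).resolve_right fun h' ↦ ?_
            rcases hπ.dvd_or_dvd h' with h' | h'
            · exact hpow _ _ h1 h'
            · exact hpow _ _ h2 h'
          · have := hdvd (i + 2)
            simp only [F, i21, i22, h, pow_zero, one_mul] at this
            refine (hπ.dvd_or_dvd this).resolve_right fun h' ↦ ?_
            rcases hπ.dvd_or_dvd h' with h' | h'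
            · exact hpow _ _ h2 h'
            · exact hpow _ _ h1 h'
      · obtain ⟨i, hi⟩ := H.not_dvd π hπ
        have hpow : ∀ j e, ¬ π ∣ ℓ j ^ e := fun j e h ↦ hπℓ ⟨j, hπ.dvd_of_dvd_pow h⟩
        rcases hπ.dvd_or_dvd (hdvd i) with h | h
        · exact hi h
        rcases hπ.dvd_or_dvd h with h | h
        · exact hpow _ _ h
        rcases hπ.dvd_or_dvd h with h | h <;> exact hpow _ _ h
  refine ⟨fun i ↦ φ (f i) * (x i ^ S i * (x (i + 1) ^ T (i + 1) * x (i + 2) ^ T (i + 2))),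
    fun i ↦ φ (g i) * (x i ^ S' i * (x (i + 1) ^ T' (i + 1) * x (i + 2) ^ T' (i + 2))),
    isCross_iff.2 fun i ↦ ?_⟩
  have hgi := isCross_iff.1 hg i
  simp only [F, i11, i12, i21, i22] at hgi ⊢
  have hbr : f (i + 1) * g (i + 2) * (ℓ (i + 1) ^ s (i + 1) * ℓ (i + 2) ^ t (i + 2)) -
      f (i + 2) * g (i + 1) * (ℓ (i + 2) ^ s (i + 2) * ℓ (i + 1) ^ t (i + 1)) =
        ℓ i ^ (m i - t i) := by
    refine mul_left_cancel₀ (pow_ne_zero (t i) (hℓ i).ne_zero) ?_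
    rw [← pow_add, Nat.add_sub_cancel' (htm i), ← hgi]
    ring
  have hxS : ∀ j, x j ^ S j * x j ^ T' j = φ (ℓ j) ^ s j := fun j ↦ by
    rw [hφ, ← pow_add, hS, pow_mul]
  have hxT : ∀ j, x j ^ T j * x j ^ S' j = φ (ℓ j) ^ t j := fun j ↦ by
    rw [hφ, ← pow_add, hT, pow_mul]
  have hxQ : x i ^ T i * x i ^ T' i * φ (ℓ i) ^ (m i - t i) = x i ^ Q := by
    rw [hφ, ← pow_add, ← pow_mul, ← pow_add, hQ]
  rw [← hxQ, ← map_pow, ← hbr]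
  simp only [map_sub, map_mul, map_pow]
  rw [← hxS, ← hxS, ← hxT, ← hxT]
  ring

end Cross

theorem RegPair.of_mul {R : Type*} [CommRing R] {a b c d : R} (h : RegPair (a * c) (b * d)) :
    RegPair a b := by
  refine ⟨fun t ht ↦ h.eq_zero t (by linear_combination c * ht), fun t t' e ↦ ?_⟩
  obtain ⟨m, hm⟩ := h.dvd (c * t) (d * t') (by linear_combination c * d * e)
  exact ⟨m, sub_eq_zero.1 (h.eq_zero _ (by linear_combination a * hm))⟩

theorem regPair_root_pow {k R : Type*} [Field k] [CommRing R] [Algebra k R] {n : ℕ} (hn : 0 < n)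
    (φ : MvPolynomial (Fin 2) k →ₐ[k] R) (x : Fin 3 → R) (hφ : ∀ i, φ (linForm k i) = x i ^ n)
    (hreg : ∀ a b, RegPair a b → RegPair (φ a) (φ b)) (Q : ℕ) : RegPair (x 0 ^ Q) (x 2 ^ Q) := by
  have h := hreg _ _ (regPair_linForm_pow fun _ ↦ Q)
  simp only [map_pow, hφ, ← pow_mul] at h
  obtain ⟨m, rfl⟩ : ∃ m, n = 1 + m := Nat.exists_eq_add_of_le hn
  rw [add_mul, one_mul, pow_add, pow_add] at h
  exact h.of_mul

theorem IsSyzygy.exists_free {k : Type*} [Field k] {p : ℕ} [Fact p.Prime] [CharP k p] {n e α : ℕ}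
    {a : Fin 3 → ℕ} {f : Fin 3 → MvPolynomial (Fin 2) k} (H : IsSyzygy a α f) (hn : 0 < n)
    (hs : 0 < score n (p ^ e) a α) {R : Type*} [CommRing R] [Algebra k R]
    (φ : MvPolynomial (Fin 2) k →ₐ[k] R) (x : Fin 3 → R) (hφ : ∀ i, φ (linForm k i) = x i ^ n)
    (hreg : ∀ a b, RegPair a b → RegPair (φ a) (φ b)) :
    ∃ e', Module.Free R (SyzOf fun i ↦ x i ^ p ^ e') := by
  obtain ⟨a, α, f, H, hs⟩ := H.exists_reduced hs
  have hj : 3 * n < p ^ (3 * n) := Nat.lt_pow_self (Fact.out : p.Prime).one_lt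
  obtain ⟨F, G, hFG⟩ := (H.frobenius p (3 * n)).exists_isCross (Q := p ^ (3 * n) * p ^ e) hn (by
    rw [score_mul]
    have : ((3 * n : ℕ) : ℤ) < (p ^ (3 * n) : ℕ) := by exact_mod_cast hj
    push_cast at this ⊢
    nlinarith) φ x hφ
  rw [← pow_add] at hFG
  exact ⟨_, hFG.free_syzOf (regPair_root_pow hn φ x hφ hreg _)⟩

/-- If no syzygy destabilizes, the splitting type of every plane syzygy bundle is nearly
balanced. -/
theorem exists_planeLength_eq (k : Type*) [Field k] {n q : ℕ}
    (hs : ∀ (a : Fin 3 → ℕ) (α : ℕ) (f : Fin 3 → MvPolynomial (Fin 2) k), IsSyzygy a α f →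
      score n q a α ≤ 0) (a b c : ℕ) :
    ∃ D δ γ : ℕ, planeLength k a b c = D ∧
      4 * D + 2 * (a ^ 2 + b ^ 2 + c ^ 2) = (a + b + c) ^ 2 + δ ^ 2 ∧ δ + 2 * γ = a + b + c ∧
      (n : ℤ) * δ ≤ |(n : ℤ) * a - q| + |(n : ℤ) * b - q| + |(n : ℤ) * c - q| := by
  obtain ⟨α, β, D, f, g, H, hsum, hD, hq⟩ := exists_isPlaneBasis k a b c
  wlog hαβ : α ≤ β generalizing α β f g
  · exact this β α g (-f) H.swap (by omega) (by omega) (by omega)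
  obtain ⟨δ, rfl⟩ := Nat.exists_eq_add_of_le hαβ
  refine ⟨D, δ, α, hD, ?_, by omega, ?_⟩
  · rw [← hsum]
    linarith
  · by_contra! h
    have hpos : 0 < score n q ![a, b, c] α := by
      have e : (a : ℤ) + b + c = 2 * α + δ := by omega
      rw [score, Fin.sum_univ_three]
      simp only [Matrix.cons_val]
      linear_combination h - (n : ℤ) * e
    refine absurd (hs _ _ f (IsSyzygy.of_score_pos ?_ ?_ (fun i ↦ (H.left i).totalDegree_le) hpos))
      (not_le.2 hpos)
    · rintro rfl
      have := H.cross.zero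
      simp only [Pi.zero_apply, zero_mul, sub_zero] at this
      exact pow_ne_zero _ (linForm_ne_zero k 0) this.symm
    · rw [Fin.sum_univ_three]
      exact H.cross.dot_left

theorem sum_ite_lt {n r : ℕ} (hr : r ≤ n) (A B : ℚ) :
    ∑ i : Fin n, (if (i : ℕ) < r then A else B) = r * A + (n - r) * B := by
  rw [Fin.sum_univ_eq_sum_range (fun i ↦ if i < r then A else B) n,
    ← Finset.sum_range_add_sum_Ico _ hr,
    Finset.sum_congr rfl fun i hi ↦ if_pos (Finset.mem_range.1 hi),
    Finset.sum_congr rfl fun i hi ↦ if_neg (not_lt.2 (Finset.mem_Ico.1 hi).1)]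
  simp [Nat.cast_sub hr]

/-- The splitting gaps at the corners next to `q / n` are at most one. -/
theorem gap_le_one {p n e θ r : ℕ} (hp : p.Prime) (hcop : p.Coprime n) (hn : 1 < n)
    (h23 : ¬ (p = 2 ∧ n = 3)) (hq : n * θ + r = p ^ e) (hr : r < n)
    {δ : ℕ → ℕ → ℕ → ℕ} {γ : ℕ → ℕ → ℕ → ℕ} (hγ : ∀ a b c, δ a b c + 2 * γ a b c = a + b + c)
    (hδ : ∀ a b c, (n : ℤ) * δ a b c ≤ |(n : ℤ) * a - (p ^ e : ℕ)| + |(n : ℤ) * b - (p ^ e : ℕ)| +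
      |(n : ℤ) * c - (p ^ e : ℕ)|)
    {a b c : ℕ} (ha : a = θ ∨ a = θ + 1) (hb : b = θ ∨ b = θ + 1) (hc : c = θ ∨ c = θ + 1) :
    δ a b c ≤ 1 := by
  have hqn : (p ^ e).Coprime n := hcop.pow_left e
  have hr0 : 0 < r := by
    rcases Nat.eq_zero_or_pos r with rfl | h
    · have := Nat.eq_one_of_dvd_coprimes hqn (⟨θ, by omega⟩ : n ∣ p ^ e) dvd_rfl
      omega
    · exact h
  have habs : |(n : ℤ) * θ - (p ^ e : ℕ)| = r := by
    rw [← hq]; push_cast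
    rw [show (n : ℤ) * θ - (n * θ + r) = -r by ring, abs_neg, Nat.abs_cast]
  have habs' : |(n : ℤ) * (θ + 1 : ℕ) - (p ^ e : ℕ)| = n - r := by
    rw [← hq]; push_cast
    rw [show (n : ℤ) * (θ + 1) - (n * θ + r) = n - r by ring, abs_of_nonneg]
    omega
  have lt_of : ∀ {d m : ℕ} {S : ℤ}, (n : ℤ) * d ≤ S → S < n * m → d < m := by
    intro d m S h1 h2
    exact_mod_cast lt_of_mul_lt_mul_left (h1.trans_lt h2) (by positivity)
  have heven : Even (p ^ e) → n = 3 → False := by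
    intro h1 h2
    refine h23 ⟨?_, h2⟩
    have : 2 ∣ p := Nat.prime_two.dvd_of_dvd_pow (even_iff_two_dvd.1 h1)
    exact ((Nat.prime_dvd_prime_iff_eq Nat.prime_two hp).1 this).symm
  have h0 := hδ θ θ θ
  have h3 := hδ (θ + 1) (θ + 1) (θ + 1)
  have g0 := hγ θ θ θ
  have g3 := hγ (θ + 1) (θ + 1) (θ + 1)
  simp only [habs, habs'] at h0 h3
  have hlow : δ θ θ θ ≤ 1 := by
    have : δ θ θ θ < 3 := lt_of h0 (by push_cast; omega)
    by_contra h2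
    have e2 : δ θ θ θ = 2 := by omega
    have e3 : 1 ≤ δ (θ + 1) (θ + 1) (θ + 1) := by omega
    rw [e2] at h0
    have h3' : (n : ℤ) * 1 ≤ n * δ (θ + 1) (θ + 1) (θ + 1) :=
      mul_le_mul_of_nonneg_left (by exact_mod_cast e3) (by positivity)
    have hnr : 3 * r = 2 * n := by push_cast at h0; omega
    have : n ∣ 3 := by
      refine hqn.symm.dvd_of_dvd_mul_right (n := p ^ e) ⟨3 * θ + 2, ?_⟩
      rw [← hq]; linarith
    have hn3 : n = 3 := ((Nat.dvd_prime Nat.prime_three).1 this).resolve_left (by omega)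
    refine heven ?_ hn3
    rw [← hq, hn3, Nat.even_iff]
    omega
  have hhigh : δ (θ + 1) (θ + 1) (θ + 1) ≤ 1 := by
    have : δ (θ + 1) (θ + 1) (θ + 1) < 3 := lt_of h3 (by push_cast; omega)
    by_contra h2
    have e2 : δ (θ + 1) (θ + 1) (θ + 1) = 2 := by omega
    have e3 : 1 ≤ δ θ θ θ := by omega
    rw [e2] at h3
    have h0' : (n : ℤ) * 1 ≤ n * δ θ θ θ :=
      mul_le_mul_of_nonneg_left (by exact_mod_cast e3) (by positivity)
    have hnr : n = 3 * r := by push_cast at h3; omega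
    have : r = 1 := Nat.eq_one_of_dvd_coprimes hqn (by rw [← hq, hnr]; exact ⟨3 * θ + 1, by ring⟩)
      (by rw [hnr]; exact ⟨3, by ring⟩)
    refine heven ?_ (by omega)
    rw [← hq, hnr, this, Nat.even_iff]
    omega
  have h := hδ a b c
  rcases ha with rfl | rfl <;> rcases hb with rfl | rfl <;> rcases hc with rfl | rfl <;>
    simp only [habs, habs'] at h <;> first | assumption | skip
  all_goals exact Nat.lt_succ_iff.1 (lt_of h (by push_cast; omega))

/-- The Hilbert–Kunz sum over the eight corners. -/
theorem corner_sum {n q : ℕ} (hn : 0 < n) {D : ℕ → ℕ → ℕ → ℕ}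
    (hD : ∀ a b c, (a = q / n ∨ a = q / n + 1) → (b = q / n ∨ b = q / n + 1) →
      (c = q / n ∨ c = q / n + 1) →
        4 * D a b c + 2 * (a ^ 2 + b ^ 2 + c ^ 2) = (a + b + c) ^ 2 + (a + b + c) % 2) :
    ((∑ l : Fin n, ∑ j : Fin n, ∑ i : Fin n, D
        (if (i : ℕ) < q % n then q / n + 1 else q / n)
        (if (j : ℕ) < q % n then q / n + 1 else q / n)
        (if (l : ℕ) < q % n then q / n + 1 else q / n) : ℕ) : ℚ) =
      if Even (q / n) then
        3 * (n : ℚ) / 4 * (q : ℚ) ^ 2 - 3 * (n : ℚ) / 4 * ((q % n : ℕ) : ℚ) ^ 2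
          + ((q % n : ℕ) : ℚ) ^ 3
      else
        3 * (n : ℚ) / 4 * (q : ℚ) ^ 2 - 3 * (n : ℚ) / 4 * ((n : ℚ) - ((q % n : ℕ) : ℚ)) ^ 2
          + ((n : ℚ) - ((q % n : ℕ) : ℚ)) ^ 3 := by
  have hq : (q : ℚ) = n * (q / n : ℕ) + (q % n : ℕ) := by exact_mod_cast (Nat.div_add_mod q n).symm
  have hr := (Nat.mod_lt q hn).le
  rw [hq]
  set θ := q / n
  set r := q % n
  have key : ∀ g : ℕ → ℚ, ∑ i : Fin n, g (if (i : ℕ) < r then θ + 1 else θ) =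
      r * g (θ + 1) + (n - r) * g θ := by
    intro g
    rw [← sum_ite_lt hr]
    exact Finset.sum_congr rfl fun i _ ↦ apply_ite g _ _ _
  push_cast
  rw [key fun c ↦ ∑ j : Fin n, ∑ i : Fin n, (D (if (i : ℕ) < r then θ + 1 else θ)
    (if (j : ℕ) < r then θ + 1 else θ) c : ℚ),
    key fun b ↦ ∑ i : Fin n, (D (if (i : ℕ) < r then θ + 1 else θ) b (θ + 1) : ℚ),
    key fun b ↦ ∑ i : Fin n, (D (if (i : ℕ) < r then θ + 1 else θ) b θ : ℚ),
    key fun a ↦ (D a (θ + 1) (θ + 1) : ℚ), key fun a ↦ (D a θ (θ + 1) : ℚ),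
    key fun a ↦ (D a (θ + 1) θ : ℚ), key fun a ↦ (D a θ θ : ℚ)]
  have val : ∀ a b c ε, (a = θ ∨ a = θ + 1) → (b = θ ∨ b = θ + 1) → (c = θ ∨ c = θ + 1) →
      (a + b + c) % 2 = ε →
      (D a b c : ℚ) = ((a + b + c) ^ 2 + ε - 2 * (a ^ 2 + b ^ 2 + c ^ 2)) / 4 := by
    intro a b c ε ha hb hc hε
    have := hD a b c ha hb hc
    rw [hε] at this
    have : (4 * D a b c + 2 * (a ^ 2 + b ^ 2 + c ^ 2) : ℚ) = (a + b + c) ^ 2 + ε := by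
      exact_mod_cast this
    linear_combination this / 4
  split_ifs with h
  · rw [Nat.even_iff] at h
    rw [val θ θ θ 0 (by simp) (by simp) (by simp) (by omega),
      val (θ + 1) θ θ 1 (by simp) (by simp) (by simp) (by omega),
      val θ (θ + 1) θ 1 (by simp) (by simp) (by simp) (by omega),
      val θ θ (θ + 1) 1 (by simp) (by simp) (by simp) (by omega),
      val (θ + 1) (θ + 1) θ 0 (by simp) (by simp) (by simp) (by omega),
      val (θ + 1) θ (θ + 1) 0 (by simp) (by simp) (by simp) (by omega),
      val θ (θ + 1) (θ + 1) 0 (by simp) (by simp) (by simp) (by omega),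
      val (θ + 1) (θ + 1) (θ + 1) 1 (by simp) (by simp) (by simp) (by omega)]
    push_cast
    ring
  · rw [Nat.not_even_iff] at h
    rw [val θ θ θ 1 (by simp) (by simp) (by simp) (by omega),
      val (θ + 1) θ θ 0 (by simp) (by simp) (by simp) (by omega),
      val θ (θ + 1) θ 0 (by simp) (by simp) (by simp) (by omega),
      val θ θ (θ + 1) 0 (by simp) (by simp) (by simp) (by omega),
      val (θ + 1) (θ + 1) θ 1 (by simp) (by simp) (by simp) (by omega),
      val (θ + 1) θ (θ + 1) 1 (by simp) (by simp) (by simp) (by omega),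
      val θ (θ + 1) (θ + 1) 1 (by simp) (by simp) (by simp) (by omega),
      val (θ + 1) (θ + 1) (θ + 1) 0 (by simp) (by simp) (by simp) (by omega)]
    push_cast
    ring

theorem finrank_eq_of_length_eq {k M : Type*} [Field k] [AddCommGroup M] [Module k M] {N : ℕ}
    (h : Module.length k M = N) : Module.finrank k M = N := by
  have : IsFiniteLength k M := Module.length_ne_top_iff.1 (h ▸ ENat.natCast_ne_top N)
  have : Module.Finite k M := by
    have := (isFiniteLength_iff_isNoetherian_isArtinian.1 this).1
    infer_instance
  rw [Module.length_eq_finrank] at h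
  exact_mod_cast h

/-- Let `R = k[X,Y,Z]/(X^n+Y^n+Z^n)` over an algebraically closed field of
characteristic `p > 0` with `gcd(p,n) = 1`.  Assume `Syz_C(X,Y,Z)` on `C = Proj R`
is strongly semistable and not trivialized by Frobenius; equivalently (Brinkmann,
Cor. 7.9/Rem. 7.10), no Frobenius power `Syz_R(X^q,Y^q,Z^q)` is a free `R`-module
(i.e. every `R/(X^q,Y^q,Z^q)` has infinite projective dimension).  Writing
`q = p^e = nθ + r` with `0 ≤ r < n`, then
`HKF(R,q) = (3n/4)q² - (3n/4)r² + r³` if `θ` is even, and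
`HKF(R,q) = (3n/4)q² - (3n/4)(n-r)² + (n-r)³` if `θ` is odd. -/
theorem stmt19 (k : Type*) [Field k] [IsAlgClosed k] (p n : ℕ) (hp : p.Prime) [CharP k p]
    (hn : 1 ≤ n) (hcop : Nat.Coprime p n) :
    ∀ I : Ideal (MvPolynomial (Fin 3) k), I = Ideal.span {X 0 ^ n + X 1 ^ n + X 2 ^ n} →
    ∀ x y z : MvPolynomial (Fin 3) k ⧸ I,
      x = Ideal.Quotient.mk I (X 0) → y = Ideal.Quotient.mk I (X 1) →
      z = Ideal.Quotient.mk I (X 2) →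
      -- `Syz_C(X,Y,Z)` is strongly semistable and not trivialized by the Frobenius:
      (∀ e : ℕ, ¬ Module.Free (MvPolynomial (Fin 3) k ⧸ I)
          (SyzOf ![x ^ p ^ e, y ^ p ^ e, z ^ p ^ e])) →
      ∀ e : ℕ,
        (Even (p ^ e / n) →
          (Module.finrank k
              ((MvPolynomial (Fin 3) k ⧸ I) ⧸
                Ideal.span {x ^ p ^ e, y ^ p ^ e, z ^ p ^ e}) : ℚ) =
            3 * (n : ℚ) / 4 * (p : ℚ) ^ (2 * e)
              - 3 * (n : ℚ) / 4 * ((p ^ e % n : ℕ) : ℚ) ^ 2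
              + ((p ^ e % n : ℕ) : ℚ) ^ 3) ∧
        (¬ Even (p ^ e / n) →
          (Module.finrank k
              ((MvPolynomial (Fin 3) k ⧸ I) ⧸
                Ideal.span {x ^ p ^ e, y ^ p ^ e, z ^ p ^ e}) : ℚ) =
            3 * (n : ℚ) / 4 * (p : ℚ) ^ (2 * e)
              - 3 * (n : ℚ) / 4 * ((n : ℚ) - ((p ^ e % n : ℕ) : ℚ)) ^ 2
              + ((n : ℚ) - ((p ^ e % n : ℕ) : ℚ)) ^ 3) := by
  intro I hI x y z hx hy hz hfree e
  have : Fact p.Prime := ⟨hp⟩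
  have hn0 : 0 < n := hn
  have hrel : x ^ n + y ^ n + z ^ n = 0 := by
    rw [hx, hy, hz, ← map_pow, ← map_pow, ← map_pow, ← map_add, ← map_add,
      Ideal.Quotient.eq_zero_iff_mem, hI]
    exact Ideal.mem_span_singleton_self _
  obtain ⟨φ, hφ, hreg, hlen⟩ := fermat_tower k hn0 I hI
  have hvec : ∀ q, (![x ^ q, y ^ q, z ^ q] : Fin 3 → MvPolynomial (Fin 3) k ⧸ I) =
      fun i ↦ Ideal.Quotient.mk I (X i) ^ q := by
    intro q
    ext i
    fin_cases i <;> simp [hx, hy, hz]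
  have hnotcross : ∀ (e : ℕ) (F G : Fin 3 → MvPolynomial (Fin 3) k ⧸ I),
      ¬ IsCross F G ![x ^ p ^ e, y ^ p ^ e, z ^ p ^ e] := by
    intro e F G H
    refine hfree e (H.free_syzOf ?_)
    rw [hvec]
    exact regPair_root_pow hn0 φ _ hφ hreg _
  have hn1 : 1 < n := by
    by_contra h
    obtain rfl : n = 1 := by omega
    refine hnotcross 0 ![1, 1, 1] ![0, z, -y] ⟨?_, ?_, ?_⟩
    · simp; linear_combination -hrel
    · simp
    · simp
  have h23 : ¬ (p = 2 ∧ n = 3) := by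
    rintro ⟨rfl, rfl⟩
    have h2 : (2 : MvPolynomial (Fin 3) k ⧸ I) = 0 := by
      have : (2 : k) = 0 := by exact_mod_cast CharP.cast_eq_zero k 2
      rw [← map_ofNat (algebraMap k (MvPolynomial (Fin 3) k ⧸ I)) 2, this, map_zero]
    refine hnotcross 3 ![x ^ 4, y ^ 4, z ^ 4] ![y ^ 2 * z ^ 2, x ^ 2 * z ^ 2, x ^ 2 * y ^ 2]
      ⟨?_, ?_, ?_⟩
    · simp
      linear_combination x ^ 2 * (-x ^ 3 + y ^ 3 + z ^ 3) * hrel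
        - x ^ 2 * z ^ 3 * (y ^ 3 + z ^ 3) * h2
    · simp
      linear_combination y ^ 2 * (-y ^ 3 + z ^ 3 + x ^ 3) * hrel
        - y ^ 2 * x ^ 3 * (z ^ 3 + x ^ 3) * h2
    · simp
      linear_combination z ^ 2 * (-z ^ 3 + x ^ 3 + y ^ 3) * hrel
        - z ^ 2 * y ^ 3 * (x ^ 3 + y ^ 3) * h2
  have hscore : ∀ (a : Fin 3 → ℕ) (α : ℕ) (f : Fin 3 → MvPolynomial (Fin 2) k), IsSyzygy a α f →
      score n (p ^ e) a α ≤ 0 := by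
    intro a α f H
    by_contra! h
    obtain ⟨e', he'⟩ := H.exists_free hn0 h φ _ hφ hreg
    exact hfree e' (by rwa [hvec])
  choose D δ γ hD hδ hγ hgap using exists_planeLength_eq k hscore
  have hD' : ∀ a b c, (a = p ^ e / n ∨ a = p ^ e / n + 1) → (b = p ^ e / n ∨ b = p ^ e / n + 1) →
      (c = p ^ e / n ∨ c = p ^ e / n + 1) →
        4 * D a b c + 2 * (a ^ 2 + b ^ 2 + c ^ 2) = (a + b + c) ^ 2 + (a + b + c) % 2 := by
    intro a b c ha hb hc
    have h1 := gap_le_one hp hcop hn1 h23 (Nat.div_add_mod _ n) (Nat.mod_lt _ hn0) hγ hgap ha hb hc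
    have h2 := hγ a b c
    rw [hδ a b c]
    obtain h | h : δ a b c = 0 ∨ δ a b c = 1 := by omega
    · rw [h] at h2 ⊢; omega
    · rw [h] at h2 ⊢; omega
  have hrank := hlen (p ^ e)
  rw [← hx, ← hy, ← hz] at hrank
  simp only [hD, ← Nat.cast_sum] at hrank
  have hfin := corner_sum hn0 hD'
  rw [← finrank_eq_of_length_eq hrank] at hfin
  have hpow : (p : ℚ) ^ (2 * e) = ((p ^ e : ℕ) : ℚ) ^ 2 := by push_cast; ring
  rw [hpow, hfin]
  exact ⟨fun h ↦ if_pos h, fun h ↦ if_neg h⟩
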